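/- arXiv:1304.6703 — 3 statements merged into one kernel-verified Lean document; each statement's English description precedes it below -/
import Mathlib

section
/- Let m ≥ 2 and let h₁,…,h_m be integrable even real functions on 𝕋 = (−π,π] belonging to the class F₁(𝕋) := { f ∈ L¹(𝕋) : ∑_{k∈ℤ} |k| |f̂(k)| < ∞ }. Then Δ_B(T) := | (1/T)·tr[B_T(h₁)⋯B_T(h_m)] − (2π)^{m−1} ∫_{−π}^{π} h₁(λ)⋯h_m(λ) dλ | = O(T^{−1}) as T → ∞. -/
open MeasureTheory Filter Set Asymptotics Real
open scoped ENNReal Topology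

noncomputable section

/-- Fourier coefficient on the torus. -/
def fcT (h : ℝ → ℝ) (t : ℤ) : ℂ :=
  ∫ x in Ioc (-π) π, Complex.exp (Complex.I * x * t) * (h x)

/-- T × T Toeplitz matrix. -/
def BT (n : ℕ) (h : ℝ → ℝ) : Matrix (Fin n) (Fin n) ℂ :=
  fun s t => fcT h ((s : ℤ) - (t : ℤ))

def traceProdB {m : ℕ} (n : ℕ) (h : Fin m → ℝ → ℝ) : ℂ :=
  Matrix.trace ((List.ofFn (fun i => BT n (h i))).prod)

def ΔB {m : ℕ} (h : Fin m → ℝ → ℝ) (n : ℕ) : ℝ :=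
  ‖(n : ℂ)⁻¹ * traceProdB n h
    - (((2 * π) ^ (m - 1) * ∫ x in Ioc (-π) π, ∏ i, h i x : ℝ) : ℂ)‖

/-- The class F₁(𝕋) of integrable functions with ∑ |k|·|f̂(k)| < ∞. -/
def memF1T (h : ℝ → ℝ) : Prop :=
  IntegrableOn h (Ioc (-π) π) ∧ Summable (fun k : ℤ => (|k| : ℝ) * ‖fcT h k‖)

theorem uniq_aux (u : ℝ → ℂ) (hu : IntegrableOn u (Ioc (-π) π))
    (h0 : ∀ k : ℤ, ∫ x in Ioc (-π) π, Complex.exp (Complex.I * x * k) * u x = 0) :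
    ∀ᵐ x ∂(volume.restrict (Ioc (-π) π)), u x = 0 := by
  have : Fact (0 < 2 * π) := ⟨Real.two_pi_pos⟩
  have hint : ∀ φ : C(AddCircle (2 * π), ℂ),
      IntegrableOn (fun x : ℝ => φ (x : AddCircle (2 * π)) * u x) (Ioc (-π) π) := by
    intro φ
    refine Integrable.bdd_mul (c := ‖φ‖) hu ?_ ?_
    · exact (φ.continuous.comp (AddCircle.continuous_mk' _)).aestronglyMeasurable
    · exact Eventually.of_forall fun x => φ.norm_coe_le_norm _
  let Λ₀ : C(AddCircle (2 * π), ℂ) →ₗ[ℂ] ℂ :=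
    { toFun := fun φ => ∫ x in Ioc (-π) π, φ (x : AddCircle (2 * π)) * u x
      map_add' := by
        intro φ ψ
        rw [← integral_add (hint φ) (hint ψ)]
        simp [add_mul]
      map_smul' := by
        intro a φ
        simp only [ContinuousMap.smul_apply, smul_eq_mul, RingHom.id_apply, mul_assoc]
        rw [integral_const_mul] }
  let Λ : C(AddCircle (2 * π), ℂ) →L[ℂ] ℂ := Λ₀.mkContinuous
    (∫ x in Ioc (-π) π, ‖u x‖) (by
      intro φ
      change ‖∫ x in Ioc (-π) π, φ (x : AddCircle (2 * π)) * u x‖ ≤ _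
      refine (norm_integral_le_integral_norm _).trans ?_
      rw [mul_comm (∫ x in Ioc (-π) π, ‖u x‖), ← integral_const_mul]
      refine integral_mono (hint φ).norm (hu.norm.const_mul _) ?_
      intro x
      simp only [norm_mul]
      gcongr
      exact φ.norm_coe_le_norm _)
  have hΛ : ∀ φ : C(AddCircle (2 * π), ℂ), Λ φ = 0 := by
    have hle : (Submodule.span ℂ (Set.range (@fourier (2 * π)))).topologicalClosure ≤
        LinearMap.ker Λ.toLinearMap := by
      apply Submodule.topologicalClosure_minimal
      · rw [Submodule.span_le]
        rintro _ ⟨k, rfl⟩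
        change ∫ x in Ioc (-π) π, fourier k (x : AddCircle (2 * π)) * u x = 0
        rw [← h0 k]
        congr 1
        ext x
        rw [fourier_coe_apply]
        congr 2
        have : (π : ℂ) ≠ 0 := by exact_mod_cast Real.pi_ne_zero
        push_cast
        field_simp
      · exact ContinuousLinearMap.isClosed_ker Λ
    intro φ
    have : φ ∈ (⊤ : Submodule ℂ C(AddCircle (2 * π), ℂ)) := trivial
    rw [← span_fourier_closure_eq_top] at this
    exact hle this
  rw [← Measure.restrict_congr_set (Ioo_ae_eq_Ioc (μ := volume) (a := -π) (b := π)),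
    ae_restrict_iff' measurableSet_Ioo]
  refine IsOpen.ae_eq_zero_of_integral_contDiff_smul_eq_zero isOpen_Ioo
    ((hu.mono_set Ioo_subset_Ioc_self).locallyIntegrableOn) ?_
  intro g hg _ hsupp
  have hgz : ∀ x, x ∉ Ioo (-π) π → g x = 0 := fun x hx =>
    image_eq_zero_of_notMem_tsupport (fun h => hx (hsupp h))
  have hcont : Continuous (AddCircle.liftIco (2 * π) (-π) (fun x => (g x : ℂ))) := by
    apply AddCircle.liftIco_continuous
    · rw [hgz (-π) (by simp), hgz (-π + 2 * π) (by simp; intro; linarith)]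
    · exact (Complex.continuous_ofReal.comp hg.continuous).continuousOn
  have key := hΛ ⟨_, hcont⟩
  change ∫ x in Ioc (-π) π, AddCircle.liftIco (2 * π) (-π) (fun x => (g x : ℂ))
    (x : AddCircle (2 * π)) * u x = 0 at key
  rw [← setIntegral_congr_set (Ioo_ae_eq_Ioc (μ := volume) (a := -π) (b := π))] at key
  rw [← key, ← setIntegral_eq_integral_of_forall_compl_eq_zero (s := Ioo (-π) π)]
  · refine setIntegral_congr_fun measurableSet_Ioo ?_
    intro x hx
    simp only []
    rw [AddCircle.liftIco_coe_apply ⟨hx.1.le, by linarith [hx.2]⟩, Complex.real_smul]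
  · intro x hx
    rw [hgz x hx, zero_smul]

theorem norm_exp_aux (x : ℝ) (j : ℤ) : ‖Complex.exp (-(Complex.I * x * j))‖ = 1 := by
  have : -(Complex.I * x * j) = ((-(x * j) : ℝ) : ℂ) * Complex.I := by push_cast; ring
  rw [this, Complex.norm_exp_ofReal_mul_I]

theorem norm_exp_aux' (x : ℝ) (j : ℤ) : ‖Complex.exp (Complex.I * x * j)‖ = 1 := by
  have : (Complex.I * x * j) = (((x * j) : ℝ) : ℂ) * Complex.I := by push_cast; ring
  rw [this, Complex.norm_exp_ofReal_mul_I]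

/-- The Fourier series with coefficients `d`. -/
def FS (d : ℤ → ℂ) (x : ℝ) : ℂ := ∑' j : ℤ, d j * Complex.exp (-(Complex.I * x * j))

theorem orth_aux (l : ℤ) : ∫ x in Ioc (-π) π, Complex.exp (Complex.I * (x : ℝ) * l)
    = if l = 0 then 2 * π else 0 := by
  rw [← intervalIntegral.integral_of_le (by linarith [Real.pi_pos])]
  split_ifs with h
  · simp [h]; ring
  · have hc : Complex.I * l ≠ 0 := by simp [h]
    have := integral_exp_mul_complex (a := -π) (b := π) hc
    simp only [mul_right_comm _ _ (l : ℂ)]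
    rw [this]
    have e : Complex.exp (Complex.I * l * (π : ℝ)) = Complex.exp (Complex.I * l * ((-π : ℝ) : ℂ)) := by
      rw [Complex.exp_eq_exp_iff_exists_int]
      exact ⟨l, by push_cast; ring⟩
    rw [e]; simp

theorem FS_summable (d : ℤ → ℂ) (hd : Summable fun j => ‖d j‖) (x : ℝ) :
    Summable fun j : ℤ => ‖d j * Complex.exp (-(Complex.I * x * j))‖ := by
  simpa only [norm_mul, norm_exp_aux, mul_one] using hd

theorem FS_cont (d : ℤ → ℂ) (hd : Summable fun j => ‖d j‖) : Continuous (FS d) := by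
  refine continuous_tsum (u := fun j => ‖d j‖) (fun j => by fun_prop) hd ?_
  intro j x
  rw [norm_mul, norm_exp_aux, mul_one]

theorem FS_coeff (d : ℤ → ℂ) (hd : Summable fun j => ‖d j‖) (k : ℤ) :
    ∫ x in Ioc (-π) π, Complex.exp (Complex.I * (x : ℝ) * k) * FS d x = 2 * π * d k := by
  have hfin : IsFiniteMeasure (volume.restrict (Ioc (-π) π)) := inferInstance
  have hF : ∀ j : ℤ, Integrable (fun x : ℝ => Complex.exp (Complex.I * x * k) *
      (d j * Complex.exp (-(Complex.I * x * j)))) (volume.restrict (Ioc (-π) π)) := by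
    intro j
    have : Continuous (fun x : ℝ => Complex.exp (Complex.I * x * k) *
      (d j * Complex.exp (-(Complex.I * x * j)))) := by fun_prop
    exact (this.integrableOn_Icc (a := -π) (b := π)).mono_set Ioc_subset_Icc_self
  have h := hasSum_integral_of_summable_integral_norm hF (by
    simp only [norm_mul, norm_exp_aux, norm_exp_aux', mul_one, one_mul]
    simp only [integral_const, smul_eq_mul]
    exact hd.mul_left _)
  have e1 : ∀ x : ℝ, Complex.exp (Complex.I * x * k) * FS d x
      = ∑' j : ℤ, Complex.exp (Complex.I * x * k) *
      (d j * Complex.exp (-(Complex.I * x * j))) := by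
    intro x; rw [FS, tsum_mul_left]
  simp only [e1]
  rw [← h.tsum_eq]
  have e2 : ∀ j : ℤ, ∫ x in Ioc (-π) π, Complex.exp (Complex.I * (x : ℝ) * k) *
      (d j * Complex.exp (-(Complex.I * (x : ℝ) * j))) = if j = k then 2 * π * d j else 0 := by
    intro j
    have : ∀ x : ℝ, Complex.exp (Complex.I * x * k) *
      (d j * Complex.exp (-(Complex.I * x * j))) = d j * Complex.exp (Complex.I * x * (k - j : ℤ)) := by
      intro x
      rw [mul_left_comm, ← Complex.exp_add]
      congr 2
      push_cast; ring
    simp only [this]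
    rw [integral_const_mul, orth_aux]
    by_cases h : j = k
    · simp [h]; ring
    · have : k - j ≠ 0 := by omega
      simp [h, this]
  simp only [e2]
  rw [tsum_ite_eq]

theorem F1_summable (h : ℝ → ℝ) (hh : memF1T h) : Summable fun k => ‖fcT h k‖ := by
  have h1 := hh.2
  have h2 : Summable fun k : ℤ => (if k = 0 then ‖fcT h k‖ else 0) + (|k| : ℝ) * ‖fcT h k‖ := by
    refine Summable.add ?_ h1
    exact (hasSum_ite_eq (0 : ℤ) (‖fcT h 0‖)).summable.congr (by
      intro k; split_ifs with hk <;> simp [hk])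
  refine Summable.of_nonneg_of_le (fun _ => norm_nonneg _) ?_ h2
  intro k
  split_ifs with hk
  · simp [hk]
  · have : (1 : ℝ) ≤ |(k : ℝ)| := by exact_mod_cast Int.one_le_abs hk
    nlinarith [norm_nonneg (fcT h k)]

theorem F1_series (h : ℝ → ℝ) (hh : memF1T h) :
    ∀ᵐ x ∂(volume.restrict (Ioc (-π) π)), (2 * π : ℂ) * h x = FS (fcT h) x := by
  have hs := F1_summable h hh
  have hFi : IntegrableOn (FS (fcT h)) (Ioc (-π) π) :=
    ((FS_cont _ hs).integrableOn_Icc (a := -π) (b := π)).mono_set Ioc_subset_Icc_self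
  have hhi : IntegrableOn (fun x => (2 * π : ℂ) * h x) (Ioc (-π) π) :=
    (Integrable.ofReal hh.1).const_mul _
  have := uniq_aux (fun x => (2 * π : ℂ) * h x - FS (fcT h) x) (hhi.sub hFi) (by
    intro k
    have bd : ∀ v : ℝ → ℂ, IntegrableOn v (Ioc (-π) π) →
        IntegrableOn (fun x : ℝ => Complex.exp (Complex.I * x * k) * v x) (Ioc (-π) π) := by
      intro v hv
      refine Integrable.bdd_mul (c := 1) hv ?_ ?_
      · exact Continuous.aestronglyMeasurable (by fun_prop)
      · exact Eventually.of_forall fun x => (norm_exp_aux' x k).le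
    simp only [mul_sub]
    rw [integral_sub (bd _ hhi) (bd _ hFi), FS_coeff _ hs]
    simp only [mul_left_comm _ (2 * π : ℂ)]
    rw [integral_const_mul, fcT, sub_self])
  filter_upwards [this] with x hx
  exact sub_eq_zero.mp hx

def cv (c d : ℤ → ℂ) (k : ℤ) : ℂ := ∑' j : ℤ, c j * d (k - j)

def shEquiv : ℤ × ℤ ≃ ℤ × ℤ where
  toFun p := (p.2, p.1 - p.2)
  invFun p := (p.1 + p.2, p.1)
  left_inv p := by ext <;> simp
  right_inv p := by ext <;> simp

theorem cv_norm_summable (c d : ℤ → ℂ) (hc : Summable fun j => ‖c j‖)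
    (hd : Summable fun j => ‖d j‖) :
    Summable fun p : ℤ × ℤ => ‖c p.2 * d (p.1 - p.2)‖ := by
  have := hc.mul_norm hd
  exact (shEquiv.summable_iff (f := fun p : ℤ × ℤ => ‖c p.1 * d p.2‖)).mpr this

theorem cv_summable (c d : ℤ → ℂ) (hc : Summable fun j => ‖c j‖)
    (hd : Summable fun j => ‖d j‖) : Summable fun k => ‖cv c d k‖ := by
  have h := cv_norm_summable c d hc hd
  refine Summable.of_nonneg_of_le (fun _ => norm_nonneg _) (fun k => ?_) h.prod
  exact norm_tsum_le_tsum_norm (h.prod_factor k)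

theorem cv_FS (c d : ℤ → ℂ) (hc : Summable fun j => ‖c j‖)
    (hd : Summable fun j => ‖d j‖) (x : ℝ) : FS c x * FS d x = FS (cv c d) x := by
  have h1 := FS_summable c hc x
  have h2 := FS_summable d hd x
  rw [FS, FS, tsum_mul_tsum_of_summable_norm h1 h2, ← shEquiv.tsum_eq]
  have e : ∀ p : ℤ × ℤ, c (shEquiv p).1 * Complex.exp (-(Complex.I * x * (shEquiv p).1)) *
      (d (shEquiv p).2 * Complex.exp (-(Complex.I * x * (shEquiv p).2)))
      = c p.2 * d (p.1 - p.2) * Complex.exp (-(Complex.I * x * p.1)) := by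
    intro p
    simp only [shEquiv, Equiv.coe_fn_mk]
    rw [mul_mul_mul_comm, ← Complex.exp_add]
    congr 2
    push_cast; ring
  simp only [e]
  have hs : Summable fun p : ℤ × ℤ => c p.2 * d (p.1 - p.2) *
      Complex.exp (-(Complex.I * x * p.1)) := by
    apply Summable.of_norm
    simp only [norm_mul _ (Complex.exp _), norm_exp_aux, mul_one]
    exact cv_norm_summable c d hc hd
  rw [hs.tsum_prod, FS]
  congr 1; ext k
  rw [cv, ← tsum_mul_right]

/-- Toeplitz matrix of a sequence. -/
def Tp (n : ℕ) (c : ℤ → ℂ) : Matrix (Fin n) (Fin n) ℂ := fun s t => c ((s : ℤ) - (t : ℤ))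

theorem count_aux (n : ℕ) (k : ℤ) :
    ∑ s : Fin n, (if (s : ℤ) - k < 0 ∨ (n : ℤ) ≤ s - k then (1 : ℝ) else 0) ≤ |(k : ℝ)| := by
  rw [Finset.sum_boole]
  have : (Finset.univ.filter fun s : Fin n => (s : ℤ) - k < 0 ∨ (n : ℤ) ≤ s - k).card
      ≤ (Finset.range k.natAbs).card := by
    apply Finset.card_le_card_of_injOn (fun s : Fin n => if 0 ≤ k then (s : ℕ) else n - 1 - (s : ℕ))
    · intro s hs
      have := s.2
      simp at hs ⊢
      split_ifs <;> omega
    · intro s hs t ht hst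
      have := s.2
      have := t.2
      simp only at hst
      ext
      split_ifs at hst <;> omega
  rw [Finset.card_range] at this
  calc _ ≤ (k.natAbs : ℝ) := by exact_mod_cast this
    _ = _ := by rw [Nat.cast_natAbs]; simp

theorem err_aux (c d : ℤ → ℂ) (hc : Summable fun j => ‖c j‖)
    (hcw : Summable fun k : ℤ => |(k : ℝ)| * ‖c k‖)
    (hd : Summable fun j => ‖d j‖) (n : ℕ) :
    ∑ s, ∑ t, ‖(Tp n c * Tp n d - Tp n (cv c d)) s t‖
      ≤ (∑' k : ℤ, |(k : ℝ)| * ‖c k‖) * ∑' j, ‖d j‖ := by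
  set D := ∑' j, ‖d j‖ with hD
  let χ : Fin n → ℤ → ℝ := fun s k => if (s : ℤ) - k < 0 ∨ (n : ℤ) ≤ s - k then 1 else 0
  have hχ0 : ∀ s k, 0 ≤ χ s k := fun s k => by simp only [χ]; split_ifs <;> norm_num
  have hχ1 : ∀ s k, χ s k ≤ 1 := fun s k => by simp only [χ]; split_ifs <;> norm_num
  have hfac : ∀ l : ℤ, Summable fun k => ‖c k * d (l - k)‖ :=
    fun l => (cv_norm_summable c d hc hd).prod_factor l
  have hχs : ∀ (s : Fin n) (l : ℤ), Summable fun k => χ s k * ‖c k * d (l - k)‖ := by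
    intro s l
    refine Summable.of_nonneg_of_le (fun k => mul_nonneg (hχ0 s k) (norm_nonneg _)) (fun k => ?_)
      (hfac l)
    exact mul_le_of_le_one_left (norm_nonneg _) (hχ1 s k)
  have hχs' : ∀ (s : Fin n), Summable fun k => χ s k * ‖c k‖ := by
    intro s
    refine Summable.of_nonneg_of_le (fun k => mul_nonneg (hχ0 s k) (norm_nonneg _)) (fun k => ?_) hc
    exact mul_le_of_le_one_left (norm_nonneg _) (hχ1 s k)
  -- entrywise bound
  have h1 : ∀ s t : Fin n, ‖(Tp n c * Tp n d - Tp n (cv c d)) s t‖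
      ≤ ∑' k, χ s k * ‖c k * d ((s : ℤ) - t - k)‖ := by
    intro s t
    have e1 : (Tp n c * Tp n d) s t =
        ∑' k : ℤ, ((1 - χ s k : ℝ) : ℂ) * (c k * d ((s : ℤ) - t - k)) := by
      rw [Matrix.mul_apply]
      have inj : Function.Injective (fun r : Fin n => (s : ℤ) - (r : ℤ)) := by
        intro a b hab
        ext
        simp only at hab
        omega
      rw [← inj.tsum_eq, tsum_fintype]
      · refine Finset.sum_congr rfl fun r _ => ?_
        have hr := r.2
        have : χ s ((s : ℤ) - r) = 0 := by
          simp only [χ]; rw [if_neg]; omega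
        rw [this]
        simp only [Tp, sub_zero, Complex.ofReal_one, one_mul]
        congr 2; ring
      · intro k hk
        by_contra hk'
        apply hk
        have : χ s k = 1 := by
          simp only [χ]
          rw [if_pos]
          by_contra hcon
          push Not at hcon
          apply hk'
          refine ⟨⟨((s : ℤ) - k).toNat, by omega⟩, ?_⟩
          simp only
          omega
        simp [this]
    have hsA : Summable fun k => c k * d ((s : ℤ) - t - k) := (hfac _).of_norm
    have hsB : Summable fun k => ((χ s k : ℝ) : ℂ) * (c k * d ((s : ℤ) - t - k)) := by
      apply Summable.of_norm
      refine (hχs s ((s : ℤ) - t)).congr fun k => ?_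
      rw [norm_mul ((χ s k : ℝ) : ℂ), Complex.norm_real, Real.norm_of_nonneg (hχ0 s k)]
    have e2 : (Tp n c * Tp n d - Tp n (cv c d)) s t =
        -∑' k : ℤ, ((χ s k : ℝ) : ℂ) * (c k * d ((s : ℤ) - t - k)) := by
      rw [Matrix.sub_apply, e1]
      simp only [Complex.ofReal_sub, Complex.ofReal_one, sub_mul, one_mul]
      rw [hsA.tsum_sub hsB]
      simp only [Tp, cv]
      ring
    rw [e2, norm_neg]
    refine (norm_tsum_le_tsum_norm hsB.norm).trans (le_of_eq ?_)
    congr 1; ext k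
    rw [norm_mul, Complex.norm_real, Real.norm_of_nonneg (hχ0 s k)]
  have h2 : ∀ (s : Fin n) (k : ℤ), ∑ t : Fin n, ‖d ((s : ℤ) - t - k)‖ ≤ D := by
    intro s k
    have inj : Function.Injective (fun t : Fin n => (s : ℤ) - (t : ℤ) - k) := by
      intro a b hab
      ext
      simp only at hab
      omega
    have := tsum_comp_le_tsum_of_inj hd (fun _ => norm_nonneg _) inj
    rwa [tsum_fintype] at this
  calc ∑ s, ∑ t, ‖(Tp n c * Tp n d - Tp n (cv c d)) s t‖
      ≤ ∑ s : Fin n, ∑ t : Fin n, ∑' k, χ s k * ‖c k * d ((s : ℤ) - t - k)‖ :=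
        Finset.sum_le_sum fun s _ => Finset.sum_le_sum fun t _ => h1 s t
    _ = ∑ s : Fin n, ∑' k, ∑ t : Fin n, χ s k * ‖c k * d ((s : ℤ) - t - k)‖ := by
        refine Finset.sum_congr rfl fun s _ => ?_
        rw [Summable.tsum_finsetSum]
        intro t _
        exact hχs s _
    _ ≤ ∑ s : Fin n, ∑' k, χ s k * ‖c k‖ * D := by
        refine Finset.sum_le_sum fun s _ => ?_
        refine Summable.tsum_le_tsum (fun k => ?_)
          (summable_sum fun t _ => hχs s _) ((hχs' s).mul_right _)
        simp only [norm_mul, ← mul_assoc]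
        rw [← Finset.mul_sum]
        exact mul_le_mul_of_nonneg_left (h2 s k) (mul_nonneg (hχ0 s k) (norm_nonneg _))
    _ = ∑' k, ∑ s : Fin n, χ s k * ‖c k‖ * D := by
        rw [Summable.tsum_finsetSum]
        intro s _
        exact (hχs' s).mul_right _
    _ ≤ ∑' k : ℤ, |(k : ℝ)| * ‖c k‖ * D := by
        refine Summable.tsum_le_tsum (fun k => ?_)
          (summable_sum fun s _ => (hχs' s).mul_right _) (hcw.mul_right _)
        rw [← Finset.sum_mul, ← Finset.sum_mul]
        have := count_aux n k
        have hD0 : 0 ≤ D := tsum_nonneg fun _ => norm_nonneg _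
        gcongr
    _ = _ := tsum_mul_right

theorem mul_bound (c : ℤ → ℂ) (hc : Summable fun j => ‖c j‖) (n : ℕ)
    (M : Matrix (Fin n) (Fin n) ℂ) :
    ∑ s, ∑ t, ‖(Tp n c * M) s t‖ ≤ (∑' j, ‖c j‖) * ∑ s, ∑ t, ‖M s t‖ := by
  have h2 : ∀ r : Fin n, ∑ s : Fin n, ‖c ((s : ℤ) - r)‖ ≤ ∑' j, ‖c j‖ := by
    intro r
    have inj : Function.Injective (fun s : Fin n => (s : ℤ) - (r : ℤ)) := by
      intro a b hab
      ext
      simp only at hab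
      omega
    have := tsum_comp_le_tsum_of_inj hc (fun _ => norm_nonneg _) inj
    rwa [tsum_fintype] at this
  calc ∑ s, ∑ t, ‖(Tp n c * M) s t‖
      ≤ ∑ s : Fin n, ∑ t, ∑ r : Fin n, ‖c ((s : ℤ) - r)‖ * ‖M r t‖ := by
        refine Finset.sum_le_sum fun s _ => Finset.sum_le_sum fun t _ => ?_
        rw [Matrix.mul_apply]
        refine (norm_sum_le _ _).trans (le_of_eq ?_)
        simp only [norm_mul, Tp]
    _ = ∑ r : Fin n, ∑ s : Fin n, ‖c ((s : ℤ) - r)‖ * ∑ t, ‖M r t‖ := by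
        rw [Finset.sum_comm' (t' := Finset.univ) (s' := fun _ => Finset.univ) (by simp)]
        rw [Finset.sum_comm]
        rw [Finset.sum_comm (s := Finset.univ) (t := Finset.univ)
          (f := fun (r : Fin n) (s : Fin n) => ‖c ((s : ℤ) - r)‖ * ∑ t, ‖M r t‖)]
        refine Finset.sum_congr rfl fun s _ => ?_
        rw [Finset.sum_comm]
        simp only [Finset.mul_sum]
    _ ≤ ∑ r : Fin n, (∑' j, ‖c j‖) * ∑ t, ‖M r t‖ := by
        refine Finset.sum_le_sum fun r _ => ?_
        rw [← Finset.sum_mul]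
        exact mul_le_mul_of_nonneg_right (h2 r) (Finset.sum_nonneg fun _ _ => norm_nonneg _)
    _ = _ := by rw [Finset.mul_sum]

theorem list_aux (L : List (ℝ → ℝ)) (hL : ∀ f ∈ L, memF1T f) :
    ∃ d : ℤ → ℂ, (Summable fun j => ‖d j‖) ∧
      (∀ᵐ x ∂(volume.restrict (Ioc (-π) π)),
        (((2 * π) ^ L.length * (L.map (fun f => f x)).prod : ℝ) : ℂ) = FS d x) ∧
      ∃ C : ℝ, ∀ n : ℕ, ∑ s, ∑ t, ‖((L.map (BT n)).prod - Tp n d) s t‖ ≤ C := by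
  induction L with
  | nil =>
    refine ⟨fun j => if j = 0 then 1 else 0, ?_, ?_, 0, ?_⟩
    · refine (hasSum_ite_eq (0 : ℤ) (1 : ℝ)).summable.congr fun k => ?_
      by_cases hk : k = 0 <;> simp [hk]
    · refine Eventually.of_forall fun x => ?_
      simp only [FS, ite_mul, zero_mul]
      rw [tsum_eq_single 0 (by intro b hb; simp [hb])]
      simp
    · intro n
      refine le_of_eq (Finset.sum_eq_zero fun s _ => Finset.sum_eq_zero fun t _ => ?_)
      simp only [List.map_nil, List.prod_nil, Matrix.sub_apply, Matrix.one_apply, Tp]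
      by_cases h : s = t
      · simp [h]
      · have : (s : ℤ) - t ≠ 0 := by
          intro h'; apply h; ext; omega
        simp [h, this]
  | cons f L ih =>
    obtain ⟨d, hd, hser, C, hC⟩ := ih fun g hg => hL g (List.mem_cons_of_mem _ hg)
    have hf := hL f List.mem_cons_self
    have hs := F1_summable f hf
    have hw : Summable fun k : ℤ => |(k : ℝ)| * ‖fcT f k‖ := hf.2
    refine ⟨cv (fcT f) d, cv_summable _ _ hs hd, ?_,
      (∑' j, ‖fcT f j‖) * C + (∑' k : ℤ, |(k : ℝ)| * ‖fcT f k‖) * ∑' j, ‖d j‖, ?_⟩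
    · filter_upwards [hser, F1_series f hf] with x hx hx'
      rw [← cv_FS _ _ hs hd, ← hx, ← hx']
      simp only [List.length_cons, List.map_cons, List.prod_cons]
      push_cast
      ring
    · intro n
      have e : ((f :: L).map (BT n)).prod - Tp n (cv (fcT f) d)
          = Tp n (fcT f) * ((L.map (BT n)).prod - Tp n d)
            + (Tp n (fcT f) * Tp n d - Tp n (cv (fcT f) d)) := by
        rw [List.map_cons, List.prod_cons, mul_sub]
        have : BT n f = Tp n (fcT f) := rfl
        rw [this]
        abel
      rw [e]
      calc _ ≤ ∑ s, ∑ t, (‖(Tp n (fcT f) * ((L.map (BT n)).prod - Tp n d)) s t‖ +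
            ‖(Tp n (fcT f) * Tp n d - Tp n (cv (fcT f) d)) s t‖) :=
            Finset.sum_le_sum fun s _ => Finset.sum_le_sum fun t _ => norm_add_le _ _
        _ ≤ _ := by
          simp only [Finset.sum_add_distrib]
          refine add_le_add ?_ (err_aux _ _ hs hw hd n)
          refine (mul_bound _ hs n _).trans ?_
          exact mul_le_mul_of_nonneg_left (hC n) (tsum_nonneg fun _ => norm_nonneg _)

theorem stmt3 (m : ℕ) (hm : 2 ≤ m) (h : Fin m → ℝ → ℝ)
    (heven : ∀ i, ∀ x : ℝ, h i (-x) = h i x)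
    (hper : ∀ i, Function.Periodic (h i) (2 * π))
    (hF1 : ∀ i, memF1T (h i)) :
    (fun n : ℕ => ΔB h n) =O[atTop] fun n : ℕ => (n : ℝ)⁻¹ := by
  obtain ⟨d, hd, hser, C, hC⟩ := list_aux (List.ofFn h) (by
    intro f hf
    obtain ⟨i, rfl⟩ := (List.mem_ofFn' h f).mp hf
    exact hF1 i)
  have hd0 : (((2 * π) ^ (m - 1) * ∫ x in Ioc (-π) π, ∏ i, h i x : ℝ) : ℂ) = d 0 := by
    have h1 := FS_coeff d hd 0
    have h2 : ∫ x in Ioc (-π) π, Complex.exp (Complex.I * (x : ℝ) * (0 : ℤ)) * FS d x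
        = ∫ x in Ioc (-π) π, (((2 * π) ^ m * ∏ i, h i x : ℝ) : ℂ) := by
      refine integral_congr_ae ?_
      filter_upwards [hser] with x hx
      rw [← hx]
      simp [List.map_ofFn, List.prod_ofFn]
    rw [h2, integral_complex_ofReal, integral_const_mul] at h1
    have hpi : (2 * π : ℂ) ≠ 0 := by exact_mod_cast Real.two_pi_pos.ne'
    apply mul_left_cancel₀ hpi
    rw [← h1]
    obtain ⟨p, rfl⟩ : ∃ p, m = p + 1 := ⟨m - 1, by omega⟩
    rw [Nat.add_sub_cancel, pow_succ]
    push_cast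
    ring
  refine IsBigO.of_bound C ?_
  filter_upwards [eventually_gt_atTop 0] with n hn
  have hn' : (n : ℂ) ≠ 0 := by exact_mod_cast hn.ne'
  have e : (n : ℂ)⁻¹ * traceProdB n h - d 0
      = (n : ℂ)⁻¹ * Matrix.trace (((List.ofFn h).map (BT n)).prod - Tp n d) := by
    rw [Matrix.trace_sub]
    have : Matrix.trace (Tp n d) = n * d 0 := by
      simp [Matrix.trace, Tp]
    rw [this, mul_sub, inv_mul_cancel_left₀ hn', traceProdB, List.map_ofFn]
    rfl
  rw [ΔB, hd0, e, norm_norm, norm_mul, norm_inv, Complex.norm_natCast, norm_inv,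
    Real.norm_natCast, mul_comm]
  refine mul_le_mul_of_nonneg_right ?_ (by positivity)
  refine le_trans ?_ (hC n)
  rw [Matrix.trace]
  refine (norm_sum_le _ _).trans ?_
  refine Finset.sum_le_sum fun s _ => ?_
  exact Finset.single_le_sum (f := fun t => ‖(((List.ofFn h).map (BT n)).prod - Tp n d) s t‖)
    (fun _ _ => norm_nonneg _) (Finset.mem_univ s)
end
end

section
/- Let m ≥ 2 and let h₁,…,h_m be even real functions on 𝕋 = (−π,π], differentiable on 𝕋\{0}, such that for some constants C_{1i}, C_{2i} > 0 and exponents α_i with 0 < α_i < 1 and α := α₁ + ⋯ + α_m < 1 one has |h_i(λ)| ≤ C_{1i}|λ|^{−α_i} and |h_i′(λ)| ≤ C_{2i}|λ|^{−(α_i+1)} for all λ ∈ 𝕋\{0} and i = 1,…,m. Then for every ε > 0, Δ_B(T) := | (1/T)·tr[B_T(h₁)⋯B_T(h_m)] − (2π)^{m−1} ∫_{−π}^{π} h₁(λ)⋯h_m(λ) dλ | = O(T^{−γ+ε}) as T → ∞, where γ = (1 − α)/m. -/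
open MeasureTheory Filter Set Asymptotics Real
open scoped ENNReal Topology

noncomputable section

/-! ### Closed paths and traces -/

/-- The path starting at `s` with steps `u` stays in `[0,n)` and ends at `s'`. -/
def GoodPath (n : ℕ) : (m : ℕ) → ℤ → ℤ → (Fin m → ℤ) → Prop
  | 0, s, s', _ => s = s'
  | (m + 1), s, s', u => (0 ≤ s - u 0 ∧ s - u 0 < n) ∧ GoodPath n m (s - u 0) s' (Fin.tail u)

lemma GoodPath.sum_eq {n : ℕ} : ∀ {m : ℕ} {s s' : ℤ} {u : Fin m → ℤ},
    GoodPath n m s s' u → s' = s - ∑ i, u i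
  | 0, s, s', u, hg => by
      have : s = s' := hg
      simp [this]
  | (m + 1), s, s', u, hg => by
      have := GoodPath.sum_eq hg.2
      rw [this, Fin.sum_univ_succ]
      simp only [Fin.tail]
      ring

lemma goodPath_of {n : ℕ} : ∀ {m : ℕ} {s s' : ℤ} {u : Fin m → ℤ},
    s' = s - ∑ i, u i → 0 ≤ s - ∑ i, |u i| → s + ∑ i, |u i| < n → GoodPath n m s s' u
  | 0, s, s', u, h1, _, _ => by
      change s = s'
      simp [h1]
  | (m + 1), s, s', u, h1, h2, h3 => by
      rw [Fin.sum_univ_succ] at h1 h2 h3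
      have h0 : 0 ≤ ∑ i : Fin m, |u i.succ| := Finset.sum_nonneg fun _ _ => abs_nonneg _
      have ha := neg_abs_le (u 0)
      have hb := le_abs_self (u 0)
      refine ⟨⟨by linarith, by linarith⟩, goodPath_of ?_ ?_ ?_⟩
      · simp only [Fin.tail]; linarith
      · simp only [Fin.tail]; linarith
      · simp only [Fin.tail]; linarith

/-- Toeplitz matrix with symbol coefficients `c`. -/
def TM (n : ℕ) (c : ℤ → ℂ) : Matrix (Fin n) (Fin n) ℂ := fun s t => c ((s : ℤ) - (t : ℤ))

open Classical in
lemma hasSum_listProd (n : ℕ) : ∀ (m : ℕ) (c : Fin m → ℤ → ℂ) (s s' : Fin n),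
    HasSum (fun u : Fin m → ℤ => if GoodPath n m s s' u then ∏ i, c i (u i) else 0)
      ((List.ofFn (fun i => TM n (c i))).prod s s')
  | 0, c, s, s' => by
      have : ((List.ofFn (fun i => TM n (c i))).prod s s') = if s = s' then 1 else 0 := by
        simp [Matrix.one_apply]
      rw [this]
      convert! hasSum_unique (fun u : Fin 0 → ℤ =>
        if GoodPath n 0 s s' u then ∏ i, c i (u i) else 0) using 1
      have hgp : ∀ d : Fin 0 → ℤ, (GoodPath n 0 s s' d) ↔ s = s' := by
        intro d
        change ((s : ℤ) = s') ↔ _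
        rw [Fin.ext_iff]; omega
      by_cases hs : s = s'
      · rw [if_pos hs, if_pos ((hgp _).2 hs)]; simp
      · rw [if_neg hs, if_neg (fun hh => hs ((hgp _).1 hh))]
  | (m + 1), c, s, s' => by
      have ih := hasSum_listProd n m (fun i => c i.succ)
      rw [List.ofFn_succ, List.prod_cons, Matrix.mul_apply]
      have key : ∀ r : Fin n, HasSum (fun u : Fin (m + 1) → ℤ =>
          if u 0 = (s : ℤ) - r ∧ GoodPath n m r s' (Fin.tail u) then ∏ i, c i (u i) else 0)
          (c 0 ((s : ℤ) - r) * (List.ofFn (fun i : Fin m => TM n (c i.succ))).prod r s') := by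
        intro r
        have hinj : Function.Injective (fun v : Fin m → ℤ =>
            (Fin.cons ((s : ℤ) - r) v : Fin (m + 1) → ℤ)) := by
          intro a b hab
          exact (Fin.cons_inj.1 hab).2
        rw [← hinj.hasSum_iff]
        · convert! (ih r s').mul_left (c 0 ((s : ℤ) - r)) using 1
          funext v
          simp [Function.comp, Fin.prod_univ_succ, Fin.tail_cons]
        · intro u hu
          rw [if_neg]
          rintro ⟨h0, -⟩
          apply hu
          refine ⟨Fin.tail u, ?_⟩
          change (Fin.cons ((s : ℤ) - r) (Fin.tail u) : Fin (m + 1) → ℤ) = u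
          rw [← h0, Fin.cons_self_tail]
      convert! hasSum_sum (fun r (_ : r ∈ Finset.univ) => key r) using 1
      funext u
      by_cases hg : GoodPath n (m + 1) s s' u
      · rw [if_pos hg]
        obtain ⟨⟨h1, h2⟩, h3⟩ := hg
        have hlt : ((s : ℤ) - u 0).toNat < n := by omega
        have hval : (((⟨((s : ℤ) - u 0).toNat, hlt⟩ : Fin n) : ℕ) : ℤ) = (s : ℤ) - u 0 := by
          simp [Int.toNat_of_nonneg h1]
        rw [Finset.sum_eq_single (⟨((s : ℤ) - u 0).toNat, hlt⟩ : Fin n)]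
        · rw [if_pos]
          rw [hval]
          exact ⟨by ring, h3⟩
        · intro b _ hb
          rw [if_neg]
          rintro ⟨h0, -⟩
          apply hb
          ext
          simp only
          omega
        · intro hh; exact absurd (Finset.mem_univ _) hh
      · rw [if_neg hg]
        symm
        apply Finset.sum_eq_zero
        intro r _
        rw [if_neg]
        rintro ⟨h0, h1⟩
        apply hg
        have : (s : ℤ) - u 0 = r := by omega
        refine ⟨?_, ?_⟩
        · rw [this]; have := r.2; omega
        · rw [this]; exact h1

open Classical in
/-- number of starting points of closed good paths -/
def cntPath (n m : ℕ) (u : Fin m → ℤ) : ℕ :=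
  (Finset.univ.filter (fun s : Fin n => GoodPath n m s s u)).card

lemma cntPath_le (n m : ℕ) (u : Fin m → ℤ) : cntPath n m u ≤ n := by
  classical
  unfold cntPath
  exact (Finset.card_filter_le _ _).trans (by simp)

lemma cntPath_ge (n m : ℕ) (u : Fin m → ℤ) (hu : ∑ i, u i = 0) :
    (n : ℤ) - 2 * ∑ i, |u i| ≤ cntPath n m u := by
  classical
  obtain ⟨A, hA⟩ : ∃ A : ℕ, (A : ℤ) = ∑ i, |u i| :=
    Int.eq_ofNat_of_zero_le (Finset.sum_nonneg fun _ _ => abs_nonneg _) |>.imp fun _ h => h.symm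
  rw [← hA]
  by_cases hn : n ≤ 2 * A
  · have : (0 : ℤ) ≤ cntPath n m u := by positivity
    omega
  have hle : (Finset.univ : Finset (Fin (n - 2 * A))).card ≤ cntPath n m u := by
    unfold cntPath
    refine Finset.card_le_card_of_injOn (fun k => (⟨k + A, by have := k.2; omega⟩ : Fin n)) ?_ ?_
    · intro k _
      simp only [Finset.coe_filter, Finset.mem_univ, true_and, Set.mem_ofPred_eq]
      have := k.2
      refine goodPath_of (by simp [hu]) ?_ ?_
      · rw [← hA]; push_cast; omega
      · rw [← hA]; push_cast; omega
    · intro a _ b _ hab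
      simp only [Fin.mk.injEq] at hab
      ext; omega
  simp at hle
  omega

open Classical in
lemma hasSum_trace (n m : ℕ) (c : Fin m → ℤ → ℂ) :
    HasSum (fun u : Fin m → ℤ => (cntPath n m u : ℂ) *
        (if ∑ i, u i = 0 then ∏ i, c i (u i) else 0))
      (Matrix.trace ((List.ofFn (fun i => TM n (c i))).prod)) := by
  unfold Matrix.trace
  convert! hasSum_sum (fun s (_ : s ∈ (Finset.univ : Finset (Fin n))) =>
    hasSum_listProd n m c s s) using 1
  funext u
  rw [← Finset.sum_filter, Finset.sum_const, nsmul_eq_mul]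
  by_cases hu : ∑ i, u i = 0
  · rw [if_pos hu]; rfl
  · have h0 : (Finset.univ.filter (fun s : Fin n => GoodPath n m s s u)) = ∅ := by
      rw [Finset.filter_eq_empty_iff]
      intro s _ hg
      have := hg.sum_eq
      apply hu; linarith
    rw [if_neg hu, h0]; simp

/-! ### Summability -/

lemma summable_pi_prod : ∀ (m : ℕ) (g : Fin m → ℤ → ℝ), (∀ i t, 0 ≤ g i t) →
    (∀ i, Summable (g i)) → Summable (fun u : Fin m → ℤ => ∏ i, g i (u i))
  | 0, g, _, _ => (hasSum_unique _).summable
  | (m + 1), g, h0, hs => by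
      have ih := summable_pi_prod m (fun i => g i.succ) (fun i => h0 i.succ) (fun i => hs i.succ)
      have := (hs 0).mul_of_nonneg ih (fun t => h0 0 t)
        (fun u => Finset.prod_nonneg fun i _ => h0 i.succ _)
      rw [← (Fin.consEquiv (fun _ : Fin (m + 1) => ℤ)).summable_iff]
      convert! this using 1
      funext p
      simp [Function.comp, Fin.consEquiv, Fin.prod_univ_succ]

lemma hasSum_pi_prod : ∀ (m : ℕ) (f : Fin m → ℤ → ℂ), (∀ i, Summable (fun t => ‖f i t‖)) →
    HasSum (fun u : Fin m → ℤ => ∏ i, f i (u i)) (∏ i, ∑' t, f i t)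
  | 0, f, _ => by
      convert! hasSum_unique (fun u : Fin 0 → ℤ => ∏ i, f i (u i)) using 1
  | (m + 1), f, hs => by
      have ih := hasSum_pi_prod m (fun i => f i.succ) (fun i => hs i.succ)
      have hn := summable_pi_prod m (fun i t => ‖f i.succ t‖) (fun _ _ => norm_nonneg _)
        (fun i => hs i.succ)
      have hn' : Summable (fun u : Fin m → ℤ => ‖∏ i, f i.succ (u i)‖) := by
        simpa only [norm_prod] using hn
      have h1 := summable_mul_of_summable_norm (hs 0) hn'
      have h2 := tsum_mul_tsum_of_summable_norm (hs 0) hn'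
      have h3 := h1.hasSum
      rw [← h2, ih.tsum_eq] at h3
      rw [← (Fin.consEquiv (fun _ : Fin (m + 1) => ℤ)).hasSum_iff, Fin.prod_univ_succ]
      convert! h3 using 1
      funext p
      simp [Function.comp, Fin.consEquiv, Fin.prod_univ_succ]

lemma summable_one_add_abs {b : ℝ} (hb : b < -1) :
    Summable (fun t : ℤ => (1 + |(t : ℝ)|) ^ b) := by
  have h := Real.summable_abs_int_rpow (b := -b) (by linarith)
  rw [neg_neg] at h
  rw [← Finset.summable_compl_iff ({0} : Finset ℤ)] at h ⊢
  refine Summable.of_nonneg_of_le (fun t => by positivity) (fun t => ?_) h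
  have ht : (t : ℤ) ≠ 0 := by simpa using t.2
  have ht' : 0 < |((t : ℤ) : ℝ)| := abs_pos.2 (by exact_mod_cast ht)
  exact Real.rpow_le_rpow_of_nonpos ht' (by linarith) (by linarith)

lemma summable_zero_sum (k : ℕ) (hk : 1 ≤ k) (β : Fin (k + 1) → ℝ) (hβ : ∀ i, 0 < β i)
    (hsum : ∑ i, β i < 1) :
    Summable (fun u : {u : Fin (k + 1) → ℤ // ∑ i, u i = 0} =>
      ∏ i, (1 + |((u : Fin (k + 1) → ℤ) i : ℝ)|) ^ (β i - 1)) := by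
  set η : ℝ := (1 - ∑ i, β i) / k with hη
  have hkpos : (0 : ℝ) < k := by exact_mod_cast hk
  have hηpos : 0 < η := div_pos (by linarith) hkpos
  have hsumm : ∀ i : Fin (k + 1), Summable (fun u : {u : Fin (k + 1) → ℤ // ∑ i, u i = 0} =>
      ∏ j : Fin k, (1 + |((u : Fin (k + 1) → ℤ) (i.succAbove j) : ℝ)|) ^ (-1 - η)) := by
    intro i
    have h1 := summable_pi_prod k (fun _ t => (1 + |(t : ℝ)|) ^ (-1 - η))
      (fun _ _ => by positivity) (fun _ => summable_one_add_abs (by linarith))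
    have hinj : Function.Injective (fun u : {u : Fin (k + 1) → ℤ // ∑ i, u i = 0} =>
        (fun j : Fin k => (u : Fin (k + 1) → ℤ) (i.succAbove j))) := by
      rintro ⟨u, hu⟩ ⟨v, hv⟩ huv
      have huv' : ∀ j, u (i.succAbove j) = v (i.succAbove j) := fun j => congrFun huv j
      rw [Fin.sum_univ_succAbove _ i] at hu hv
      ext j
      rcases Fin.eq_self_or_eq_succAbove i j with hj | ⟨l, hj⟩
      · subst hj
        simp only [huv'] at hu
        simp only
        linarith
      · rw [hj]; exact huv' l
    exact h1.comp_injective hinj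
  refine Summable.of_nonneg_of_le (fun u => Finset.prod_nonneg fun i _ => by positivity) ?_
    (summable_sum (s := Finset.univ) (fun i _ => hsumm i))
  rintro ⟨u, hu⟩
  simp only
  obtain ⟨i, -, hi⟩ := Finset.exists_max_image (Finset.univ : Finset (Fin (k + 1)))
    (fun i => |u i|) ⟨0, Finset.mem_univ _⟩
  refine le_trans ?_ (Finset.single_le_sum (f := fun i : Fin (k + 1) =>
    ∏ j : Fin k, (1 + |(u (i.succAbove j) : ℝ)|) ^ (-1 - η))
    (fun i _ => Finset.prod_nonneg fun j _ => by positivity) (Finset.mem_univ i))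
  rw [Fin.prod_univ_succAbove _ i]
  have hexp : β i - 1 = ∑ j : Fin k, (-(β (i.succAbove j) + η)) := by
    rw [Finset.sum_neg_distrib, Finset.sum_add_distrib, Finset.sum_const, Finset.card_univ,
      Fintype.card_fin, nsmul_eq_mul, hη, mul_div_cancel₀ _ hkpos.ne',
      Fin.sum_univ_succAbove _ i]
    ring
  have h1 : (1 + |(u i : ℝ)|) ^ (β i - 1) ≤
      ∏ j : Fin k, (1 + |(u (i.succAbove j) : ℝ)|) ^ (-(β (i.succAbove j) + η)) := by
    rw [hexp, Real.rpow_sum_of_pos (by positivity)]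
    refine Finset.prod_le_prod (fun j _ => by positivity) (fun j _ => ?_)
    refine Real.rpow_le_rpow_of_nonpos (by positivity) ?_ ?_
    · have : |u (i.succAbove j)| ≤ |u i| := hi _ (Finset.mem_univ _)
      have : |(u (i.succAbove j) : ℝ)| ≤ |(u i : ℝ)| := by exact_mod_cast this
      linarith
    · have := hβ (i.succAbove j); linarith
  calc _ ≤ (∏ j : Fin k, (1 + |(u (i.succAbove j) : ℝ)|) ^ (-(β (i.succAbove j) + η))) *
        ∏ j : Fin k, (1 + |(u (i.succAbove j) : ℝ)|) ^ (β (i.succAbove j) - 1) := by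
        refine mul_le_mul_of_nonneg_right h1 (Finset.prod_nonneg fun j _ => by positivity)
    _ = _ := by
        rw [← Finset.prod_mul_distrib]
        refine Finset.prod_congr rfl fun j _ => ?_
        rw [← Real.rpow_add (by positivity)]
        congr 1; ring

lemma summable_zero_sum' (m : ℕ) (hm : 2 ≤ m) (β : Fin m → ℝ) (hβ : ∀ i, 0 < β i)
    (hsum : ∑ i, β i < 1) :
    Summable (fun u : Fin m → ℤ => if ∑ i, u i = 0 then
      ∏ i, (1 + |(u i : ℝ)|) ^ (β i - 1) else 0) := by
  obtain ⟨k, rfl⟩ : ∃ k, m = k + 1 := ⟨m - 1, by omega⟩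
  have h := summable_zero_sum k (by omega) β hβ hsum
  have hinj : Function.Injective (fun u : {u : Fin (k + 1) → ℤ // ∑ i, u i = 0} =>
    (u : Fin (k + 1) → ℤ)) := Subtype.val_injective
  rw [← hinj.summable_iff]
  · convert! h using 1
    funext u
    simp [Function.comp, u.2]
  · intro u hu
    rw [if_neg]
    intro h0
    exact hu ⟨⟨u, h0⟩, rfl⟩

lemma prod_bound_le (m : ℕ) (c : Fin m → ℤ → ℂ) (K α : Fin m → ℝ)
    (hc : ∀ i t, ‖c i t‖ ≤ K i * (1 + |(t : ℝ)|) ^ (α i - 1)) (u : Fin m → ℤ) :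
    ‖∏ i, c i (u i)‖ ≤ (∏ i, K i) * ∏ i, (1 + |(u i : ℝ)|) ^ (α i - 1) := by
  rw [norm_prod, ← Finset.prod_mul_distrib]
  exact Finset.prod_le_prod (fun i _ => norm_nonneg _) (fun i _ => hc i _)

lemma sum_abs_le_prod (m : ℕ) (u : Fin m → ℤ) :
    ∑ i, |(u i : ℝ)| ≤ ∏ i, (1 + |(u i : ℝ)|) := by
  have : ∀ s : Finset (Fin m), 1 + ∑ i ∈ s, |(u i : ℝ)| ≤ ∏ i ∈ s, (1 + |(u i : ℝ)|) := by
    intro s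
    induction s using Finset.cons_induction with
    | empty => simp
    | cons a s ha ih =>
      rw [Finset.sum_cons, Finset.prod_cons]
      have h1 : 0 ≤ ∑ i ∈ s, |(u i : ℝ)| := Finset.sum_nonneg fun _ _ => abs_nonneg _
      nlinarith [abs_nonneg (u a : ℝ), mul_nonneg (abs_nonneg (u a : ℝ)) h1]
  linarith [this Finset.univ]

/-- Deterministic rate in the time domain. -/
lemma trace_rate (m : ℕ) (hm : 2 ≤ m) (c : Fin m → ℤ → ℂ) (K α : Fin m → ℝ)
    (hK : ∀ i, 0 ≤ K i) (hα : ∀ i, 0 < α i) (δ : ℝ) (hδ : 0 < δ) (hδ1 : δ ≤ 1)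
    (hsum : ∑ i, (α i + δ) < 1)
    (hc : ∀ i t, ‖c i t‖ ≤ K i * (1 + |(t : ℝ)|) ^ (α i - 1)) :
    ∃ M : ℝ, ∀ n : ℕ, 1 ≤ n →
      ‖(n : ℂ)⁻¹ * Matrix.trace ((List.ofFn (fun i => TM n (c i))).prod)
        - ∑' u : Fin m → ℤ, (if ∑ i, u i = 0 then ∏ i, c i (u i) else 0)‖
        ≤ M * (n : ℝ) ^ (-δ) := by
  classical
  set F : (Fin m → ℤ) → ℂ := fun u => if ∑ i, u i = 0 then ∏ i, c i (u i) else 0 with hF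
  set G : (Fin m → ℤ) → ℝ := fun u => if ∑ i, u i = 0 then
      ∏ i, (1 + |(u i : ℝ)|) ^ ((α i + δ) - 1) else 0 with hG
  have hGs : Summable G := summable_zero_sum' m hm (fun i => α i + δ)
    (fun i => add_pos (hα i) hδ) hsum
  have hKp : 0 ≤ ∏ i, K i := Finset.prod_nonneg fun i _ => hK i
  have hFG : ∀ u, ‖F u‖ ≤ (∏ i, K i) * G u := by
    intro u
    simp only [hF, hG]
    split_ifs with h0
    · refine (prod_bound_le m c K α hc u).trans (mul_le_mul_of_nonneg_left ?_ hKp)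
      refine Finset.prod_le_prod (fun i _ => by positivity) (fun i _ => ?_)
      refine Real.rpow_le_rpow_of_exponent_le ?_ (by linarith)
      linarith [abs_nonneg (u i : ℝ)]
    · simp
  have hFs : Summable F := Summable.of_norm_bounded (hGs.mul_left _) hFG
  refine ⟨2 * (∏ i, K i) * ∑' u, G u, fun n hn => ?_⟩
  have hnpos : (0 : ℝ) < n := by exact_mod_cast hn
  have h1 := ((hasSum_trace n m c).mul_left ((n : ℂ)⁻¹)).sub hFs.hasSum
  rw [← h1.tsum_eq]
  have hb : ∀ u, ‖(n : ℂ)⁻¹ * ((cntPath n m u : ℂ) * F u) - F u‖ ≤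
      (2 * (∏ i, K i) * (n : ℝ) ^ (-δ)) * G u := by
    intro u
    by_cases h0 : ∑ i, u i = 0
    swap
    · simp [hF, hG, h0]
    have e1 : (n : ℂ)⁻¹ * ((cntPath n m u : ℂ) * F u) - F u =
        (((cntPath n m u : ℝ) / n - 1 : ℝ) : ℂ) * F u := by
      push_cast; ring
    rw [e1, norm_mul, Complex.norm_real, Real.norm_eq_abs]
    set A : ℝ := ∏ i, (1 + |(u i : ℝ)|) with hA
    have hApos : 0 < A := Finset.prod_pos fun i _ => by positivity
    have hle : (cntPath n m u : ℝ) ≤ n := by exact_mod_cast cntPath_le n m u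
    have hge : (n : ℝ) - 2 * ∑ i, |(u i : ℝ)| ≤ cntPath n m u := by
      exact_mod_cast cntPath_ge n m u h0
    have hAb := sum_abs_le_prod m u
    have hc0 : (0 : ℝ) ≤ cntPath n m u := by positivity
    have hx : |(cntPath n m u : ℝ) / n - 1| = 1 - (cntPath n m u : ℝ) / n := by
      rw [abs_of_nonpos]
      · ring
      · rw [sub_nonpos, div_le_one hnpos]; exact hle
    have hx1 : 1 - (cntPath n m u : ℝ) / n ≤ 1 := by
      have : 0 ≤ (cntPath n m u : ℝ) / n := by positivity
      linarith
    have hx2 : 1 - (cntPath n m u : ℝ) / n ≤ 2 * (A / n) := by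
      rw [sub_le_iff_le_add, mul_div_assoc', ← add_div, le_div_iff₀ hnpos]
      linarith
    have hx0 : 0 ≤ 1 - (cntPath n m u : ℝ) / n := by
      rw [sub_nonneg, div_le_one hnpos]; exact hle
    have hx3 : |(cntPath n m u : ℝ) / n - 1| ≤ 2 * (n : ℝ) ^ (-δ) * A ^ δ := by
      rw [hx]
      have e : 2 * (n : ℝ) ^ (-δ) * A ^ δ = 2 * (A / n) ^ δ := by
        rw [Real.div_rpow hApos.le hnpos.le, Real.rpow_neg hnpos.le]; ring
      rw [e]
      by_cases hAn : A / n ≤ 1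
      · have := Real.rpow_le_rpow_of_exponent_ge (by positivity : 0 < A / n) hAn hδ1
        rw [Real.rpow_one] at this
        linarith
      · have := Real.one_le_rpow (le_of_not_ge hAn) hδ.le
        linarith
    have hFu : ‖F u‖ ≤ (∏ i, K i) * ∏ i, (1 + |(u i : ℝ)|) ^ (α i - 1) := by
      simp only [hF, if_pos h0]
      exact prod_bound_le m c K α hc u
    have hGu : G u = A ^ δ * ∏ i, (1 + |(u i : ℝ)|) ^ (α i - 1) := by
      simp only [hG, if_pos h0]
      rw [hA, ← Real.finsetProd_rpow _ _ (fun i _ => by positivity), ← Finset.prod_mul_distrib]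
      refine Finset.prod_congr rfl fun i _ => ?_
      rw [← Real.rpow_add (by positivity)]
      congr 1; ring
    calc _ ≤ (2 * (n : ℝ) ^ (-δ) * A ^ δ) *
          ((∏ i, K i) * ∏ i, (1 + |(u i : ℝ)|) ^ (α i - 1)) := by
          refine mul_le_mul hx3 hFu (norm_nonneg _) (by positivity)
      _ = _ := by rw [hGu]; ring
  refine (tsum_of_norm_bounded (hGs.hasSum.mul_left _) hb).trans (le_of_eq ?_)
  ring

/-! ### Fourier coefficients of one function -/

/-- hypotheses on one symbol -/
structure SymHyp (h : ℝ → ℝ) (α C₁ C₂ : ℝ) : Prop where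
  even : ∀ x : ℝ, h (-x) = h x
  per : Function.Periodic h (2 * π)
  α_pos : 0 < α
  α_lt : α < 1
  C₁_pos : 0 < C₁
  C₂_pos : 0 < C₂
  diff : ∀ x ∈ Ioc (-π) π, x ≠ 0 → DifferentiableAt ℝ h x
  bound : ∀ x ∈ Ioc (-π) π, x ≠ 0 → |h x| ≤ C₁ * |x| ^ (-α)
  bound' : ∀ x ∈ Ioc (-π) π, x ≠ 0 → |deriv h x| ≤ C₂ * |x| ^ (-(α + 1))

lemma ivl_ofReal {f : ℝ → ℝ} {a b : ℝ} (hf : IntervalIntegrable f volume a b) :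
    IntervalIntegrable (fun x => (f x : ℂ)) volume a b := ⟨hf.1.ofReal, hf.2.ofReal⟩

namespace SymHyp

variable {h : ℝ → ℝ} {α C₁ C₂ : ℝ}

lemma mem_of_pos {x : ℝ} (h0 : 0 < x) (h1 : x ≤ π) : x ∈ Ioc (-π) π :=
  ⟨by linarith [Real.pi_pos], h1⟩

lemma intervalIntegrable_pos (H : SymHyp h α C₁ C₂) : IntervalIntegrable h volume 0 π := by
  rw [intervalIntegrable_iff_integrableOn_Ioc_of_le Real.pi_pos.le]
  have hg : IntegrableOn (fun x : ℝ => C₁ * x ^ (-α)) (Ioc 0 π) := by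
    rw [← intervalIntegrable_iff_integrableOn_Ioc_of_le Real.pi_pos.le]
    exact (intervalIntegral.intervalIntegrable_rpow' (by linarith [H.α_lt])).const_mul _
  refine Integrable.mono' hg ?_ ?_
  · refine ContinuousOn.aestronglyMeasurable ?_ measurableSet_Ioc
    intro x hx
    exact (H.diff x (mem_of_pos hx.1 hx.2) hx.1.ne').continuousAt.continuousWithinAt
  · rw [ae_restrict_iff' measurableSet_Ioc]
    refine Eventually.of_forall fun x hx => ?_
    have := H.bound x (mem_of_pos hx.1 hx.2) hx.1.ne'
    rwa [abs_of_pos hx.1] at this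

lemma intervalIntegrable (H : SymHyp h α C₁ C₂) (a b : ℝ) : IntervalIntegrable h volume a b := by
  have h1 := H.intervalIntegrable_pos
  have h2 : IntervalIntegrable h volume (-π) 0 := by
    have := (IntervalIntegrable.iff_comp_neg (by simp)).1 h1
    simp only [H.even, neg_zero] at this
    exact this.symm
  refine H.per.intervalIntegrable (t := -π) (by positivity) ?_ a b
  convert! h2.trans h1 using 1
  ring

lemma half_bound (H : SymHyp h α C₁ C₂) (τ : ℝ) (hτ : 1 ≤ |τ|) :
    ‖∫ x in (0:ℝ)..π, Complex.exp (Complex.I * x * τ) * (h x : ℂ)‖ ≤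
      (C₁ / (1 - α) + 2 * C₁ + C₂ / α) * |τ| ^ (α - 1) := by
  have hα0 := H.α_pos
  have hα1 := H.α_lt
  have hτ0 : τ ≠ 0 := by rintro rfl; simp at hτ; linarith
  set a : ℝ := |τ|⁻¹ with ha
  have hapos : 0 < a := by positivity
  have ha1 : a ≤ 1 := inv_le_one_of_one_le₀ hτ
  have haπ : a ≤ π := by linarith [Real.pi_gt_three]
  have hE : Continuous (fun x : ℝ => Complex.exp (Complex.I * x * τ)) := by fun_prop
  have hEn : ∀ x : ℝ, ‖Complex.exp (Complex.I * x * τ)‖ = 1 := by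
    intro x
    have : Complex.I * x * τ = ((x * τ : ℝ) : ℂ) * Complex.I := by push_cast; ring
    rw [this, Complex.norm_exp_ofReal_mul_I]
  have hII : ∀ p q : ℝ, IntervalIntegrable
      (fun x : ℝ => Complex.exp (Complex.I * x * τ) * (h x : ℂ)) volume p q := by
    intro p q
    exact (ivl_ofReal (H.intervalIntegrable p q)).continuousOn_mul hE.continuousOn
  rw [← intervalIntegral.integral_add_adjacent_intervals (hII 0 a) (hII a π)]
  have haexp : a * a ^ (-α) = |τ| ^ (α - 1) := by
    rw [ha, Real.inv_rpow (abs_nonneg _), ← Real.rpow_neg (abs_nonneg _), neg_neg,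
      Real.rpow_sub_one (by positivity)]
    ring
  have b1 : ‖∫ x in (0:ℝ)..a, Complex.exp (Complex.I * x * τ) * (h x : ℂ)‖ ≤
      C₁ / (1 - α) * |τ| ^ (α - 1) := by
    have hle : ‖∫ x in (0:ℝ)..a, Complex.exp (Complex.I * x * τ) * (h x : ℂ)‖ ≤
        ∫ x in (0:ℝ)..a, C₁ * x ^ (-α) := by
      refine intervalIntegral.norm_integral_le_of_norm_le hapos.le ?_ ?_
      · refine Eventually.of_forall fun x hx => ?_
        rw [norm_mul, hEn, one_mul, Complex.norm_real, Real.norm_eq_abs]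
        have := H.bound x (mem_of_pos hx.1 (hx.2.trans haπ)) hx.1.ne'
        rwa [abs_of_pos hx.1] at this
      · exact (intervalIntegral.intervalIntegrable_rpow' (by linarith)).const_mul _
    refine hle.trans (le_of_eq ?_)
    rw [intervalIntegral.integral_const_mul, integral_rpow (Or.inl (by linarith)),
      Real.zero_rpow (by linarith), ← haexp, Real.rpow_add_one hapos.ne']
    have : -α + 1 = 1 - α := by ring
    rw [this]
    ring
  have b2 : ‖∫ x in a..π, Complex.exp (Complex.I * x * τ) * (h x : ℂ)‖ ≤
      (2 * C₁ + C₂ / α) * |τ| ^ (α - 1) := by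
    have hsub : ∀ x ∈ Set.uIcc a π, 0 < x ∧ x ≤ π := by
      intro x hx
      rw [Set.uIcc_of_le haπ] at hx
      exact ⟨hapos.trans_le hx.1, hx.2⟩
    have hIτ : (Complex.I * τ : ℂ) ≠ 0 := by
      simp [hτ0]
    have hv : ∀ x ∈ Set.uIcc a π, HasDerivAt
        (fun x : ℝ => Complex.exp (Complex.I * x * τ) / (Complex.I * τ))
        (Complex.exp (Complex.I * x * τ)) x := by
      intro x _
      have h1 : HasDerivAt (fun z : ℂ => Complex.exp (Complex.I * z * τ) / (Complex.I * τ))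
          (Complex.exp (Complex.I * x * τ)) (x : ℂ) := by
        have h2 : HasDerivAt (fun z : ℂ => Complex.I * z * τ) (Complex.I * τ) (x : ℂ) := by
          simpa using ((hasDerivAt_id (x : ℂ)).const_mul Complex.I).mul_const (τ : ℂ)
        have h3 := h2.cexp.div_const (Complex.I * τ)
        rwa [mul_div_cancel_right₀ _ hIτ] at h3
      exact h1.comp_ofReal
    have hu : ∀ x ∈ Set.uIcc a π, HasDerivAt (fun x : ℝ => (h x : ℂ))
        ((deriv h x : ℝ) : ℂ) x := by
      intro x hx
      have := hsub x hx
      exact ((H.diff x (mem_of_pos this.1 this.2) this.1.ne').hasDerivAt).ofReal_comp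
    have hdint : IntervalIntegrable (fun x => deriv h x) volume a π := by
      rw [intervalIntegrable_iff_integrableOn_Ioc_of_le haπ]
      have hg : IntegrableOn (fun x : ℝ => C₂ * x ^ (-(α + 1))) (Ioc a π) := by
        rw [← intervalIntegrable_iff_integrableOn_Ioc_of_le haπ]
        refine (intervalIntegral.intervalIntegrable_rpow (Or.inr ?_)).const_mul _
        intro h0
        exact absurd (hsub 0 h0).1 (lt_irrefl _)
      refine Integrable.mono' hg (measurable_deriv h).aestronglyMeasurable ?_
      rw [ae_restrict_iff' measurableSet_Ioc]
      refine Eventually.of_forall fun x hx => ?_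
      have hx0 : 0 < x := hapos.trans hx.1
      have := H.bound' x (mem_of_pos hx0 hx.2) hx0.ne'
      rwa [abs_of_pos hx0] at this
    have hparts := intervalIntegral.integral_mul_deriv_eq_deriv_mul hu hv
      (ivl_ofReal hdint) (hE.intervalIntegrable a π)
    have hcomm : ∫ x in a..π, Complex.exp (Complex.I * x * τ) * (h x : ℂ) =
        ∫ x in a..π, (h x : ℂ) * Complex.exp (Complex.I * x * τ) := by
      congr 1; funext x; ring
    have hvn : ∀ x : ℝ, ‖Complex.exp (Complex.I * x * τ) / (Complex.I * τ)‖ = a := by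
      intro x
      rw [norm_div, hEn, norm_mul, Complex.norm_I, Complex.norm_real, Real.norm_eq_abs, ha]
      ring
    have hhn : ∀ x : ℝ, a ≤ x → x ≤ π → ‖(h x : ℂ)‖ ≤ C₁ * a ^ (-α) := by
      intro x hx hxπ
      have hx0 : 0 < x := hapos.trans_le hx
      have := H.bound x (mem_of_pos hx0 hxπ) hx0.ne'
      rw [Complex.norm_real, Real.norm_eq_abs]
      refine this.trans (mul_le_mul_of_nonneg_left ?_ H.C₁_pos.le)
      rw [abs_of_pos hx0]
      exact Real.rpow_le_rpow_of_nonpos hapos hx (by linarith)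
    have hI : ‖∫ x in a..π, ((deriv h x : ℝ) : ℂ) *
        (Complex.exp (Complex.I * x * τ) / (Complex.I * τ))‖ ≤ C₂ / α * (a * a ^ (-α)) := by
      have hle : ‖∫ x in a..π, ((deriv h x : ℝ) : ℂ) *
          (Complex.exp (Complex.I * x * τ) / (Complex.I * τ))‖ ≤
          ∫ x in a..π, (C₂ * a) * x ^ (-(α + 1)) := by
        refine intervalIntegral.norm_integral_le_of_norm_le haπ ?_ ?_
        · refine Eventually.of_forall fun x hx => ?_
          have hx0 : 0 < x := hapos.trans hx.1
          rw [norm_mul, hvn, Complex.norm_real, Real.norm_eq_abs]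
          have := H.bound' x (mem_of_pos hx0 hx.2) hx0.ne'
          rw [abs_of_pos hx0] at this
          nlinarith
        · refine (intervalIntegral.intervalIntegrable_rpow (Or.inr ?_)).const_mul _
          intro h0
          exact absurd (hsub 0 h0).1 (lt_irrefl _)
      refine hle.trans ?_
      rw [intervalIntegral.integral_const_mul, integral_rpow (Or.inr ⟨by linarith, fun h0 =>
        absurd (hsub 0 h0).1 (lt_irrefl _)⟩)]
      have e : -(α + 1) + 1 = -α := by ring
      rw [e]
      have e2 : (π ^ (-α) - a ^ (-α)) / -α = (a ^ (-α) - π ^ (-α)) / α := by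
        rw [div_neg, ← neg_div]; ring
      rw [e2]
      have e3 : C₂ / α * (a * a ^ (-α)) = C₂ * a * (a ^ (-α) / α) := by ring
      rw [e3]
      have := H.C₂_pos
      have h5 : 0 ≤ π ^ (-α) := by positivity
      gcongr
      linarith
    rw [hcomm, hparts]
    calc _ ≤ ‖(h π : ℂ)‖ * a + ‖(h a : ℂ)‖ * a + C₂ / α * (a * a ^ (-α)) := by
          refine (norm_sub_le _ _).trans (add_le_add ((norm_sub_le _ _).trans ?_) hI)
          rw [norm_mul, norm_mul, hvn, hvn]
      _ ≤ (C₁ * a ^ (-α)) * a + (C₁ * a ^ (-α)) * a + C₂ / α * (a * a ^ (-α)) := by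
          gcongr
          · exact hhn π haπ le_rfl
          · exact hhn a le_rfl haπ
      _ = _ := by rw [← haexp]; ring
  refine (norm_add_le _ _).trans ((add_le_add b1 b2).trans (le_of_eq ?_))
  ring

lemma fcT_eq (H : SymHyp h α C₁ C₂) (t : ℤ) :
    fcT h t = (∫ x in (0:ℝ)..π, Complex.exp (Complex.I * x * ((-t : ℝ) : ℂ)) * (h x : ℂ)) +
      ∫ x in (0:ℝ)..π, Complex.exp (Complex.I * x * ((t : ℝ) : ℂ)) * (h x : ℂ) := by
  have hE : Continuous (fun x : ℝ => Complex.exp (Complex.I * x * ((t : ℝ) : ℂ))) := by fun_prop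
  have hII : ∀ p q : ℝ, IntervalIntegrable
      (fun x : ℝ => Complex.exp (Complex.I * x * ((t : ℝ) : ℂ)) * (h x : ℂ)) volume p q := by
    intro p q
    exact (ivl_ofReal (H.intervalIntegrable p q)).continuousOn_mul hE.continuousOn
  unfold fcT
  rw [← intervalIntegral.integral_of_le (by linarith [Real.pi_pos])]
  have := intervalIntegral.integral_add_adjacent_intervals (hII (-π) 0) (hII 0 π)
  simp only [Complex.ofReal_intCast] at this ⊢
  rw [← this]
  congr 1
  have h2 := intervalIntegral.integral_comp_neg (a := 0) (b := π)
    (fun x : ℝ => Complex.exp (Complex.I * x * (t : ℂ)) * (h x : ℂ))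
  rw [neg_zero] at h2
  rw [← h2]
  congr 1
  funext x
  rw [H.even]
  push_cast
  congr 2
  ring

lemma fcT_bound (H : SymHyp h α C₁ C₂) :
    ∃ K : ℝ, 0 ≤ K ∧ ∀ t : ℤ, ‖fcT h t‖ ≤ K * (1 + |(t : ℝ)|) ^ (α - 1) := by
  have hα0 := H.α_pos
  have hα1 := H.α_lt
  have hC₁ := H.C₁_pos
  have hC₂ := H.C₂_pos
  set M := C₁ / (1 - α) + 2 * C₁ + C₂ / α with hM
  have hM0 : 0 ≤ M := by
    have : 0 < 1 - α := by linarith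
    positivity
  refine ⟨4 * M + ‖fcT h 0‖, by positivity, fun t => ?_⟩
  by_cases ht : t = 0
  · subst ht
    simp
    linarith
  have ht1 : 1 ≤ |(t : ℝ)| := by exact_mod_cast Int.one_le_abs ht
  have h1 := H.half_bound (t : ℝ) ht1
  have h2 := H.half_bound (-t : ℝ) (by rwa [abs_neg])
  rw [abs_neg] at h2
  have h3 : ‖fcT h t‖ ≤ 2 * M * |(t : ℝ)| ^ (α - 1) := by
    rw [H.fcT_eq t]
    refine (norm_add_le _ _).trans ((add_le_add h2 h1).trans (le_of_eq ?_))
    ring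
  have h4 : |(t : ℝ)| ^ (α - 1) ≤ 2 * (1 + |(t : ℝ)|) ^ (α - 1) := by
    have e1 : (2 * |(t : ℝ)|) ^ (α - 1) ≤ (1 + |(t : ℝ)|) ^ (α - 1) :=
      Real.rpow_le_rpow_of_nonpos (by positivity) (by linarith) (by linarith)
    rw [Real.mul_rpow (by norm_num) (abs_nonneg _)] at e1
    have e2 : (2 : ℝ)⁻¹ ≤ 2 ^ (α - 1) := by
      rw [← Real.rpow_neg_one]
      exact Real.rpow_le_rpow_of_exponent_le (by norm_num) (by linarith)
    have e3 : 0 ≤ |(t : ℝ)| ^ (α - 1) := by positivity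
    nlinarith
  have h5 : 0 ≤ (1 + |(t : ℝ)|) ^ (α - 1) := by positivity
  nlinarith [norm_nonneg (fcT h 0), mul_nonneg (norm_nonneg (fcT h 0)) h5,
    mul_le_mul_of_nonneg_left h4 (by positivity : 0 ≤ 2 * M)]

end SymHyp

/-! ### Regularisation by averages -/

/-- local average -/
def regAv (δ : ℝ) (h : ℝ → ℝ) (x : ℝ) : ℝ := δ⁻¹ * ∫ y in (0:ℝ)..δ, h (x - y)

/-- multiplier of the local average -/
def psiAv (δ : ℝ) (t : ℤ) : ℂ := (δ : ℂ)⁻¹ * ∫ y in (0:ℝ)..δ, Complex.exp (Complex.I * y * t)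

lemma norm_expI (x : ℝ) (t : ℤ) : ‖Complex.exp (Complex.I * x * t)‖ = 1 := by
  have : Complex.I * x * t = ((x * t : ℝ) : ℂ) * Complex.I := by push_cast; ring
  rw [this, Complex.norm_exp_ofReal_mul_I]

lemma norm_psiAv_le_one {δ : ℝ} (hδ : 0 < δ) (t : ℤ) : ‖psiAv δ t‖ ≤ 1 := by
  unfold psiAv
  have h1 := intervalIntegral.norm_integral_le_of_norm_le_const (a := 0) (b := δ)
    (f := fun y : ℝ => Complex.exp (Complex.I * y * t)) (C := 1)
    (fun y _ => (norm_expI y t).le)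
  rw [one_mul, sub_zero, abs_of_pos hδ] at h1
  rw [norm_mul, norm_inv, Complex.norm_real, Real.norm_eq_abs, abs_of_pos hδ]
  rw [inv_mul_le_iff₀ hδ]
  linarith

lemma norm_psiAv_le {δ : ℝ} (hδ : 0 < δ) (t : ℤ) (ht : t ≠ 0) :
    ‖psiAv δ t‖ ≤ 2 / δ * |(t : ℝ)|⁻¹ := by
  unfold psiAv
  have hc : (Complex.I * t : ℂ) ≠ 0 := by simp [ht]
  have h1 : ∫ y in (0:ℝ)..δ, Complex.exp (Complex.I * y * t) =
      ∫ y in (0:ℝ)..δ, Complex.exp ((Complex.I * t) * y) := by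
    congr 1; funext y; congr 1; ring
  rw [h1, integral_exp_mul_complex hc, norm_mul, norm_inv, Complex.norm_real, Real.norm_eq_abs,
    abs_of_pos hδ, norm_div, norm_mul, Complex.norm_I, one_mul, Complex.norm_intCast]
  have h2 : ‖Complex.exp (Complex.I * t * δ) - Complex.exp (Complex.I * t * (0 : ℝ))‖ ≤ 2 := by
    have e1 := norm_expI δ t
    refine (norm_sub_le _ _).trans ?_
    have e2 : Complex.I * t * δ = Complex.I * δ * t := by ring
    rw [e2, e1]
    simp
    norm_num
  calc _ ≤ δ⁻¹ * (2 / |(t : ℝ)|) := by gcongr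
    _ = _ := by ring

lemma tendsto_average {E : Type*} [NormedAddCommGroup E] [NormedSpace ℝ E] [CompleteSpace E]
    (g : ℝ → E) (hg : ∀ a b : ℝ, IntervalIntegrable g volume a b) (hc : ContinuousAt g 0) :
    Tendsto (fun N : ℕ => ((1 / ((N : ℝ) + 1))⁻¹ : ℝ) • ∫ y in (0:ℝ)..(1 / ((N : ℝ) + 1)), g y)
      atTop (𝓝 (g 0)) := by
  have hm : StronglyMeasurableAtFilter g (𝓝 (0 : ℝ)) := by
    refine ⟨Ioc (-1) 1, Ioc_mem_nhds (by norm_num) (by norm_num), (hg (-1) 1).1.aestronglyMeasurable⟩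
  have h1 := intervalIntegral.integral_hasDerivAt_right (hg 0 0) hm hc
  rw [hasDerivAt_iff_tendsto_slope_zero] at h1
  have h2 : Tendsto (fun N : ℕ => (1 / ((N : ℝ) + 1))) atTop (𝓝[≠] 0) := by
    rw [tendsto_nhdsWithin_iff]
    refine ⟨tendsto_one_div_add_atTop_nhds_zero_nat, Eventually.of_forall fun N => ?_⟩
    have : (0 : ℝ) < 1 / ((N : ℝ) + 1) := by positivity
    exact this.ne'
  have h3 := h1.comp h2
  simpa [Function.comp_def] using h3

lemma tendsto_psiAv (t : ℤ) :
    Tendsto (fun N : ℕ => psiAv (1 / ((N : ℝ) + 1)) t) atTop (𝓝 1) := by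
  have hE : Continuous (fun x : ℝ => Complex.exp (Complex.I * x * t)) := by fun_prop
  have := tendsto_average (fun x : ℝ => Complex.exp (Complex.I * x * t))
    (fun a b => hE.intervalIntegrable a b) hE.continuousAt
  simp only [Complex.ofReal_zero, mul_zero, zero_mul, Complex.exp_zero] at this
  refine this.congr fun N => ?_
  rw [psiAv, Complex.real_smul]
  push_cast
  rfl

lemma abs_rpow_intervalIntegrable {α : ℝ} (hα : α < 1) (a b : ℝ) :
    IntervalIntegrable (fun x : ℝ => |x| ^ (-α)) volume a b := by
  refine intervalIntegrable_of_even (fun x => by simp) (fun x hx => ?_)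
  refine (intervalIntegral.intervalIntegrable_rpow' (r := -α) (by linarith)).congr ?_
  intro y hy
  rw [Set.uIoc_of_le hx.le] at hy
  simp only
  rw [abs_of_pos hy.1]

lemma abs_rpow_integral {α : ℝ} (hα : α < 1) {b : ℝ} (hb : 0 < b) :
    ∫ x in (-b)..b, |x| ^ (-α) = 2 * (b * b ^ (-α)) / (1 - α) := by
  have h1 : ∫ x in (0:ℝ)..b, |x| ^ (-α) = b * b ^ (-α) / (1 - α) := by
    have : ∫ x in (0:ℝ)..b, |x| ^ (-α) = ∫ x in (0:ℝ)..b, x ^ (-α) := by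
      refine intervalIntegral.integral_congr fun x hx => ?_
      rw [Set.uIcc_of_le hb.le] at hx
      rw [abs_of_nonneg hx.1]
    rw [this, integral_rpow (Or.inl (by linarith)), Real.zero_rpow (by linarith),
      Real.rpow_add_one hb.ne']
    have e : -α + 1 = 1 - α := by ring
    rw [e]; ring
  have h2 : ∫ x in (-b)..0, |x| ^ (-α) = b * b ^ (-α) / (1 - α) := by
    have := intervalIntegral.integral_comp_neg (a := 0) (b := b) (fun x : ℝ => |x| ^ (-α))
    rw [neg_zero] at this
    rw [← this, ← h1]
    simp
  rw [← intervalIntegral.integral_add_adjacent_intervals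
    (abs_rpow_intervalIntegrable hα (-b) 0) (abs_rpow_intervalIntegrable hα 0 b), h1, h2]
  ring

lemma ae_ne_zero : ∀ᵐ x : ℝ, x ≠ 0 := by
  rw [ae_iff]; simp

namespace SymHyp

variable {h : ℝ → ℝ} {α C₁ C₂ : ℝ}

lemma bound_ext (H : SymHyp h α C₁ C₂) {y : ℝ} (h1 : -π - 1 ≤ y) (h2 : y ≤ π) (h0 : y ≠ 0) :
    |h y| ≤ 3 * C₁ * |y| ^ (-α) := by
  have hC := H.C₁_pos
  have hα := H.α_pos
  have hα1 := H.α_lt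
  have hπ := Real.pi_gt_three
  by_cases hy : -π < y
  · refine (H.bound y ⟨hy, h2⟩ h0).trans ?_
    have : 0 ≤ |y| ^ (-α) := by positivity
    nlinarith [mul_nonneg hC.le this]
  · push Not at hy
    have e : h y = h (y + 2 * π) := (H.per y).symm
    rw [e]
    have hz : 0 < y + 2 * π := by linarith
    refine (H.bound (y + 2 * π) (mem_of_pos hz (by linarith)) hz.ne').trans ?_
    have h3 : |y + 2 * π| ^ (-α) ≤ 3 * |y| ^ (-α) := by
      rw [abs_of_pos hz, abs_of_neg (by linarith)]
      have hny : 0 < -y := by linarith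
      calc (y + 2 * π) ^ (-α) ≤ (-y / 3) ^ (-α) :=
            Real.rpow_le_rpow_of_nonpos (by positivity) (by linarith) (by linarith)
        _ = (-y) ^ (-α) * 3 ^ α := by
            rw [Real.div_rpow hny.le (by norm_num), Real.rpow_neg (by norm_num : (0:ℝ) ≤ 3)]
            field_simp
        _ ≤ (-y) ^ (-α) * 3 ^ (1 : ℝ) := by
            gcongr
            norm_num
        _ = _ := by rw [Real.rpow_one]; ring
    nlinarith

lemma regAv_eq (δ x : ℝ) : regAv δ h x = δ⁻¹ * ∫ y in (x - δ)..x, h y := by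
  unfold regAv
  rw [intervalIntegral.integral_comp_sub_left (fun y => h y) x, sub_zero]

lemma regAv_continuous (H : SymHyp h α C₁ C₂) (δ : ℝ) : Continuous (regAv δ h) := by
  have hp := intervalIntegral.continuous_primitive H.intervalIntegrable 0
  have : regAv δ h = fun x => δ⁻¹ * ((∫ y in (0:ℝ)..x, h y) - ∫ y in (0:ℝ)..(x - δ), h y) := by
    funext x
    rw [regAv_eq, intervalIntegral.integral_interval_sub_left (H.intervalIntegrable _ _)
      (H.intervalIntegrable _ _)]
  rw [this]
  exact continuous_const.mul (hp.sub (hp.comp (continuous_id.sub continuous_const)))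

lemma regAv_periodic (H : SymHyp h α C₁ C₂) (δ : ℝ) : Function.Periodic (regAv δ h) (2 * π) := by
  intro x
  unfold regAv
  congr 2
  funext y
  rw [← H.per (x - y)]
  congr 1; ring

lemma regAv_bound (H : SymHyp h α C₁ C₂) {δ : ℝ} (hδ : 0 < δ) (hδ1 : δ ≤ 1) {x : ℝ}
    (hx : x ∈ Ioc (-π) π) (hx0 : x ≠ 0) :
    |regAv δ h x| ≤ 18 * C₁ / (1 - α) * |x| ^ (-α) := by
  have hC := H.C₁_pos
  have hα := H.α_pos
  have hα1 := H.α_lt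
  have hxp : 0 < |x| := abs_pos.2 hx0
  have h1α : 0 < 1 - α := by linarith
  rw [regAv_eq, abs_mul, abs_of_pos (inv_pos.2 hδ), inv_mul_le_iff₀ hδ]
  have hb : ‖∫ y in (x - δ)..x, h y‖ ≤ ∫ y in (x - δ)..x, 3 * C₁ * |y| ^ (-α) := by
    refine intervalIntegral.norm_integral_le_of_norm_le (by linarith) ?_
      ((abs_rpow_intervalIntegrable hα1 _ _).const_mul _)
    filter_upwards [ae_ne_zero] with y hy0 hy
    rw [Real.norm_eq_abs]
    exact H.bound_ext (by linarith [hx.1, hy.1]) (hy.2.trans hx.2) hy0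
  rw [Real.norm_eq_abs] at hb
  refine hb.trans ?_
  rw [intervalIntegral.integral_const_mul]
  by_cases hcase : 2 * δ ≤ |x|
  · have h2 : ∫ y in (x - δ)..x, |y| ^ (-α) ≤ ∫ y in (x - δ)..x, 2 * |x| ^ (-α) := by
      refine intervalIntegral.integral_mono_on (by linarith) (abs_rpow_intervalIntegrable hα1 _ _)
        (by simp) ?_
      intro y hy
      have hyx : |x| / 2 ≤ |y| := by
        have : |x| - |y| ≤ |x - y| := abs_sub_abs_le_abs_sub x y
        have h3 : |x - y| ≤ δ := by rw [abs_le]; constructor <;> linarith [hy.1, hy.2]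
        linarith
      calc |y| ^ (-α) ≤ (|x| / 2) ^ (-α) :=
            Real.rpow_le_rpow_of_nonpos (by positivity) hyx (by linarith)
        _ = |x| ^ (-α) * 2 ^ α := by
            rw [Real.div_rpow hxp.le (by norm_num), Real.rpow_neg (by norm_num : (0:ℝ) ≤ 2)]
            field_simp
        _ ≤ |x| ^ (-α) * 2 ^ (1 : ℝ) := by
            gcongr
            norm_num
        _ = _ := by rw [Real.rpow_one]; ring
    rw [intervalIntegral.integral_const, smul_eq_mul] at h2
    have e : x - (x - δ) = δ := by ring
    rw [e] at h2
    have hX : 0 ≤ |x| ^ (-α) := by positivity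
    have h4 : 18 * C₁ ≤ 18 * C₁ / (1 - α) := by
      rw [le_div_iff₀ h1α]; nlinarith
    calc 3 * C₁ * ∫ y in (x - δ)..x, |y| ^ (-α) ≤ 3 * C₁ * (δ * (2 * |x| ^ (-α))) := by gcongr
      _ = δ * (6 * C₁ * |x| ^ (-α)) := by ring
      _ ≤ δ * (18 * C₁ / (1 - α) * |x| ^ (-α)) := by
          gcongr
          linarith
  · push Not at hcase
    have h5 := abs_lt.1 hcase
    have h2 : ∫ y in (x - δ)..x, |y| ^ (-α) ≤ ∫ y in (-(3 * δ))..(3 * δ), |y| ^ (-α) := by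
      refine intervalIntegral.integral_mono_interval (by linarith) (by linarith) (by linarith)
        (Eventually.of_forall fun y => by simp only [Pi.zero_apply]; positivity)
        (abs_rpow_intervalIntegrable hα1 _ _)
    rw [abs_rpow_integral hα1 (by positivity)] at h2
    have h3 : (3 * δ) ^ (-α) ≤ |x| ^ (-α) :=
      Real.rpow_le_rpow_of_nonpos hxp (by linarith) (by linarith)
    calc 3 * C₁ * ∫ y in (x - δ)..x, |y| ^ (-α)
        ≤ 3 * C₁ * (2 * ((3 * δ) * |x| ^ (-α)) / (1 - α)) := by
          refine mul_le_mul_of_nonneg_left (h2.trans ?_) (by positivity)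
          gcongr
      _ = _ := by ring

lemma tendsto_regAv (H : SymHyp h α C₁ C₂) {x : ℝ} (hx : x ∈ Ioc (-π) π) (hx0 : x ≠ 0) :
    Tendsto (fun N : ℕ => regAv (1 / ((N : ℝ) + 1)) h x) atTop (𝓝 (h x)) := by
  have hc : ContinuousAt (fun y : ℝ => h (x - y)) 0 := by
    have h1 : ContinuousAt h (x - 0) := by
      rw [sub_zero]; exact (H.diff x hx hx0).continuousAt
    exact ContinuousAt.comp (f := fun y : ℝ => x - y) h1 (by fun_prop)
  have h2 := tendsto_average (fun y : ℝ => h (x - y)) (fun a b => by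
    have := (H.intervalIntegrable (x - a) (x - b)).comp_sub_left x
    simpa using this) hc
  simpa [regAv] using h2

lemma fcT_shift (H : SymHyp h α C₁ C₂) (t : ℤ) (y : ℝ) :
    ∫ x in Ioc (-π) π, Complex.exp (Complex.I * x * t) * (h (x - y) : ℂ) =
      Complex.exp (Complex.I * y * t) * fcT h t := by
  have hle : -π ≤ π := by linarith [Real.pi_pos]
  unfold fcT
  rw [← intervalIntegral.integral_of_le hle, ← intervalIntegral.integral_of_le hle]
  set g : ℝ → ℂ := fun x => Complex.exp (Complex.I * x * t) * (h x : ℂ) with hg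
  have hgper : Function.Periodic g (2 * π) := by
    intro x
    simp only [hg]
    rw [H.per x]
    congr 1
    rw [Complex.exp_eq_exp_iff_exists_int]
    exact ⟨t, by push_cast; ring⟩
  have h1 : ∫ x in (-π)..π, Complex.exp (Complex.I * x * t) * (h (x - y) : ℂ) =
      ∫ x in (-π)..π, Complex.exp (Complex.I * y * t) * g (x - y) := by
    congr 1; funext x
    simp only [hg]
    rw [← mul_assoc, ← Complex.exp_add]
    congr 2
    push_cast; ring
  rw [h1, intervalIntegral.integral_const_mul, intervalIntegral.integral_comp_sub_right]
  congr 1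
  have h2 := hgper.intervalIntegral_add_eq (-π - y) (-π)
  have e1 : -π - y + 2 * π = π - y := by ring
  have e2 : -π + 2 * π = π := by ring
  rwa [e1, e2] at h2

lemma fcT_regAv (H : SymHyp h α C₁ C₂) {δ : ℝ} (hδ : 0 < δ) (hδ1 : δ ≤ 1) (t : ℤ) :
    fcT (regAv δ h) t = psiAv δ t * fcT h t := by
  have hπ4 := Real.pi_le_four
  have hII : Integrable (Function.uncurry (fun x y : ℝ =>
      Complex.exp (Complex.I * x * t) * (h (x - y) : ℂ)))
      ((volume.restrict (Ioc (-π) π)).prod (volume.restrict (Ioc 0 δ))) := by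
    have hk : Integrable (Set.indicator (Ioc 0 δ) (fun _ : ℝ => (1 : ℝ))) := by
      rw [integrable_indicator_iff measurableSet_Ioc]
      exact integrableOn_const (by simp)
    have hg : Integrable (Set.indicator (Ioc (-5) 5) h) := by
      rw [integrable_indicator_iff measurableSet_Ioc]
      exact (H.intervalIntegrable (-5) 5).1
    have hconv := hk.convolution_integrand (ContinuousLinearMap.mul ℝ ℝ) hg
    have h1 : Integrable (fun p : ℝ × ℝ => h (p.1 - p.2))
        ((volume.restrict (Ioc (-π) π)).prod (volume.restrict (Ioc 0 δ))) := by
      rw [Measure.prod_restrict]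
      refine (hconv.restrict (s := Ioc (-π) π ×ˢ Ioc 0 δ)).congr ?_
      refine (ae_restrict_iff' (measurableSet_Ioc.prod measurableSet_Ioc)).2
        (Eventually.of_forall ?_)
      rintro ⟨x, y⟩ ⟨hx, hy⟩
      simp only at hx hy
      have hxy : x - y ∈ Ioc (-5 : ℝ) 5 := ⟨by linarith [hx.1, hy.2], by linarith [hx.2, hy.1]⟩
      simp only [ContinuousLinearMap.mul_apply', Set.indicator_of_mem hy,
        Set.indicator_of_mem hxy, one_mul]
    have hE : Continuous (fun p : ℝ × ℝ => Complex.exp (Complex.I * p.1 * t)) := by fun_prop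
    exact (h1.ofReal (𝕜 := ℂ)).bdd_mul (c := 1) hE.aestronglyMeasurable
      (Eventually.of_forall fun p => (norm_expI p.1 t).le)
  have e1 : fcT (regAv δ h) t = (δ : ℂ)⁻¹ * ∫ x in Ioc (-π) π, ∫ y in Ioc 0 δ,
      Complex.exp (Complex.I * x * t) * (h (x - y) : ℂ) := by
    unfold fcT
    rw [← MeasureTheory.integral_const_mul]
    congr 1; funext x
    rw [MeasureTheory.integral_const_mul, regAv, ← intervalIntegral.integral_of_le hδ.le,
      intervalIntegral.integral_ofReal]
    push_cast
    ring
  rw [e1, MeasureTheory.integral_integral_swap hII, psiAv, mul_assoc,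
    intervalIntegral.integral_of_le hδ.le, ← MeasureTheory.integral_mul_const]
  congr 2
  funext y
  exact H.fcT_shift t y

lemma fcT_regAv_summable (H : SymHyp h α C₁ C₂) {δ : ℝ} (hδ : 0 < δ) (hδ1 : δ ≤ 1) :
    Summable (fun t : ℤ => ‖fcT (regAv δ h) t‖) := by
  obtain ⟨K, hK, hb⟩ := H.fcT_bound
  have hα1 := H.α_lt
  have hs := Real.summable_abs_int_rpow (b := 2 - α) (by linarith)
  have hs' := hs.mul_left (2 / δ * K)
  rw [← Finset.summable_compl_iff ({0} : Finset ℤ)] at hs' ⊢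
  refine Summable.of_nonneg_of_le (fun t => norm_nonneg _) (fun t => ?_) hs'
  have ht : (t : ℤ) ≠ 0 := by simpa using t.2
  have ht' : 0 < |((t : ℤ) : ℝ)| := abs_pos.2 (by exact_mod_cast ht)
  rw [H.fcT_regAv hδ hδ1, norm_mul]
  have h1 : (1 + |((t : ℤ) : ℝ)|) ^ (α - 1) ≤ |((t : ℤ) : ℝ)| ^ (α - 1) :=
    Real.rpow_le_rpow_of_nonpos ht' (by linarith) (by linarith)
  calc _ ≤ (2 / δ * |((t : ℤ) : ℝ)|⁻¹) * (K * |((t : ℤ) : ℝ)| ^ (α - 1)) :=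
        mul_le_mul (norm_psiAv_le hδ t ht) ((hb t).trans (by gcongr)) (norm_nonneg _)
          (by positivity)
    _ = 2 / δ * K * |((t : ℤ) : ℝ)| ^ (-(2 - α)) := by
        have : -(2 - α) = (α - 1) - 1 := by ring
        rw [this, Real.rpow_sub_one ht'.ne' (α - 1)]
        ring

end SymHyp

/-! ### Fourier inversion and the product formula -/

lemma fourier_inversion (f : ℝ → ℝ) (hc : Continuous f) (hp : Function.Periodic f (2 * π))
    (hs : Summable (fun t : ℤ => ‖fcT f t‖)) (x : ℝ) :
    HasSum (fun t : ℤ => (2 * π : ℂ)⁻¹ * (fcT f t * Complex.exp (-(Complex.I * x * t)))) (f x : ℂ) := by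
  have : Fact (0 < 2 * π) := ⟨by positivity⟩
  have hp' : Function.Periodic (fun x : ℝ => (f x : ℂ)) (2 * π) := fun x => by
    simp only [hp x]
  have hcl : Continuous hp'.lift :=
    continuous_quot_lift _ (Complex.continuous_ofReal.comp hc)
  let F : C(AddCircle (2 * π), ℂ) := ⟨hp'.lift, hcl⟩
  have hF : ∀ x : ℝ, F (x : AddCircle (2 * π)) = (f x : ℂ) := fun x => hp'.lift_coe x
  have hπ0 : (π : ℂ) ≠ 0 := by exact_mod_cast Real.pi_ne_zero
  have hfe : ∀ (n : ℤ) (x : ℝ), fourier n (x : AddCircle (2 * π)) =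
      Complex.exp (Complex.I * x * n) := by
    intro n x
    rw [fourier_coe_apply]
    congr 1
    push_cast
    field_simp
  have hcoef : ∀ n : ℤ, fourierCoeff F n = (2 * π : ℂ)⁻¹ * fcT f (-n) := by
    intro n
    rw [fourierCoeff_eq_intervalIntegral _ n (-π)]
    have e2 : -π + 2 * π = π := by ring
    rw [e2, intervalIntegral.integral_of_le (by linarith [Real.pi_pos]), Complex.real_smul]
    push_cast
    rw [one_div, fcT]
    congr 2
    funext y
    rw [hF, hfe, smul_eq_mul]
  have hsF : Summable (fourierCoeff F) := by
    have h1 : Summable (fun n : ℤ => ‖fcT f (-n)‖) :=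
      hs.comp_injective (i := fun n : ℤ => -n) neg_injective
    refine Summable.of_norm ?_
    refine (h1.mul_left ‖(2 * π : ℂ)⁻¹‖).congr fun n => ?_
    rw [hcoef, norm_mul]
  have h2 := has_pointwise_sum_fourier_series_of_summable hsF (x : AddCircle (2 * π))
  rw [hF] at h2
  rw [← (Equiv.neg ℤ).hasSum_iff] at h2
  refine h2.congr_fun ?_
  intro t
  simp only [Function.comp, Equiv.neg_apply]
  rw [hcoef, hfe, neg_neg, smul_eq_mul]
  have e : Complex.I * (x : ℂ) * ((-t : ℤ) : ℂ) = -(Complex.I * x * t) := by push_cast; ring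
  rw [e]
  ring

lemma integral_expI (k : ℤ) :
    ∫ x in Ioc (-π) π, Complex.exp (-(Complex.I * x * k)) = if k = 0 then (2 * π : ℂ) else 0 := by
  rw [← intervalIntegral.integral_of_le (by linarith [Real.pi_pos])]
  split_ifs with h0
  · subst h0
    simp
    ring
  · have hc : (-(Complex.I * k) : ℂ) ≠ 0 := by simp [h0]
    have h1 : ∫ x in (-π)..π, Complex.exp (-(Complex.I * x * k)) =
        ∫ x in (-π)..π, Complex.exp (-(Complex.I * k) * x) := by
      congr 1; funext y; congr 1; ring
    rw [h1, integral_exp_mul_complex hc, div_eq_zero_iff]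
    left
    rw [sub_eq_zero, Complex.exp_eq_exp_iff_exists_int]
    exact ⟨-k, by push_cast; ring⟩

lemma product_formula (m : ℕ) (hm : 1 ≤ m) (f : Fin m → ℝ → ℝ) (hc : ∀ i, Continuous (f i))
    (hp : ∀ i, Function.Periodic (f i) (2 * π))
    (hs : ∀ i, Summable (fun t : ℤ => ‖fcT (f i) t‖)) :
    (((2 * π) ^ (m - 1) * ∫ x in Ioc (-π) π, ∏ i, f i x : ℝ) : ℂ) =
      ∑' u : Fin m → ℤ, (if ∑ i, u i = 0 then ∏ i, fcT (f i) (u i) else 0) := by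
  have hπ0 : (2 * π : ℂ) ≠ 0 := by
    have : (π : ℂ) ≠ 0 := by exact_mod_cast Real.pi_ne_zero
    simp [this]
  set P : (Fin m → ℤ) → ℂ := fun u => ((2 * π : ℂ)⁻¹) ^ m * ∏ i, fcT (f i) (u i) with hP
  have hPs : Summable (fun u => ‖P u‖) := by
    have := (summable_pi_prod m (fun i t => ‖fcT (f i) t‖) (fun _ _ => norm_nonneg _) hs).mul_left
      ‖((2 * π : ℂ)⁻¹) ^ m‖
    refine this.congr fun u => ?_
    simp only [hP]
    rw [norm_mul, norm_prod]
  have hnE : ∀ (x : ℝ) (k : ℤ), ‖Complex.exp (-(Complex.I * x * k))‖ = 1 := by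
    intro x k
    have := norm_expI x (-k)
    push_cast at this
    rwa [mul_neg] at this
  have hpt : ∀ x : ℝ, HasSum (fun u : Fin m → ℤ =>
      P u * Complex.exp (-(Complex.I * x * ((∑ i, u i : ℤ) : ℂ)))) ((∏ i, f i x : ℝ) : ℂ) := by
    intro x
    have h1 := fun i => fourier_inversion (f i) (hc i) (hp i) (hs i) x
    have h2 := hasSum_pi_prod m (fun i t => (2 * π : ℂ)⁻¹ *
      (fcT (f i) t * Complex.exp (-(Complex.I * x * t)))) (fun i => by
        refine ((hs i).mul_left ‖(2 * π : ℂ)⁻¹‖).congr fun t => ?_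
        rw [norm_mul, norm_mul, hnE, mul_one])
    simp only [(h1 _).tsum_eq] at h2
    rw [Complex.ofReal_prod]
    refine h2.congr_fun fun u => ?_
    simp only [hP]
    rw [Finset.prod_mul_distrib, Finset.prod_mul_distrib, Finset.prod_const, Finset.card_univ,
      Fintype.card_fin, ← Complex.exp_sum, mul_assoc]
    congr 3
    push_cast
    rw [Finset.mul_sum, Finset.sum_neg_distrib]
  have hEc : ∀ k : ℤ, Continuous (fun x : ℝ => Complex.exp (-(Complex.I * x * k))) := by
    intro k; fun_prop
  have hI := hasSum_integral_of_summable_integral_norm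
    (μ := volume.restrict (Ioc (-π) π))
    (F := fun (u : Fin m → ℤ) (x : ℝ) =>
      P u * Complex.exp (-(Complex.I * x * ((∑ i, u i : ℤ) : ℂ)))) (fun u => by
        refine Integrable.const_mul ?_ _
        exact ((hEc _).intervalIntegrable (-π) π).1) (by
        simp only [norm_mul, hnE, mul_one]
        simp only [MeasureTheory.integral_const]
        exact hPs.const_smul _)
  simp only [(hpt _).tsum_eq] at hI
  have hI2 := hI.mul_left ((2 * π : ℂ) ^ (m - 1))
  have e1 : (((2 * π) ^ (m - 1) * ∫ x in Ioc (-π) π, ∏ i, f i x : ℝ) : ℂ) =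
      (2 * π : ℂ) ^ (m - 1) * ∫ x in Ioc (-π) π, ((∏ i, f i x : ℝ) : ℂ) := by
    rw [integral_complex_ofReal]
    push_cast
    rfl
  rw [e1, ← hI2.tsum_eq]
  congr 1
  funext u
  rw [MeasureTheory.integral_const_mul, integral_expI]
  split_ifs with h0
  · simp only [hP]
    obtain ⟨k, rfl⟩ : ∃ k, m = k + 1 := ⟨m - 1, by omega⟩
    rw [Nat.add_sub_cancel, inv_pow, pow_succ]
    field_simp
  · simp

lemma product_formula_sym (m : ℕ) (hm : 2 ≤ m) (h : Fin m → ℝ → ℝ) (α C₁ C₂ : Fin m → ℝ)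
    (H : ∀ i, SymHyp (h i) (α i) (C₁ i) (C₂ i)) (hαsum : ∑ i, α i < 1) :
    (((2 * π) ^ (m - 1) * ∫ x in Ioc (-π) π, ∏ i, h i x : ℝ) : ℂ) =
      ∑' u : Fin m → ℤ, (if ∑ i, u i = 0 then ∏ i, fcT (h i) (u i) else 0) := by
  choose K hK hb using fun i => (H i).fcT_bound
  have hN0 : ∀ N : ℕ, (0 : ℝ) < 1 / ((N : ℝ) + 1) := fun N => by positivity
  have hN1 : ∀ N : ℕ, 1 / ((N : ℝ) + 1) ≤ 1 := fun N => by
    rw [div_le_one (by positivity)]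
    have : (0 : ℝ) ≤ N := by positivity
    linarith
  have hid := fun N : ℕ => product_formula m (by omega)
    (fun i => regAv (1 / ((N : ℝ) + 1)) (h i)) (fun i => (H i).regAv_continuous _)
    (fun i => (H i).regAv_periodic _) (fun i => (H i).fcT_regAv_summable (hN0 N) (hN1 N))
  have hR : Tendsto (fun N : ℕ => ∑' u : Fin m → ℤ, (if ∑ i, u i = 0 then
      ∏ i, fcT (regAv (1 / ((N : ℝ) + 1)) (h i)) (u i) else 0)) atTop
      (𝓝 (∑' u : Fin m → ℤ, (if ∑ i, u i = 0 then ∏ i, fcT (h i) (u i) else 0))) := by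
    refine tendsto_tsum_of_dominated_convergence (bound := fun u => (∏ i, K i) *
      (if ∑ i, u i = 0 then ∏ i, (1 + |(u i : ℝ)|) ^ (α i - 1) else 0))
      ((summable_zero_sum' m hm α (fun i => (H i).α_pos) hαsum).mul_left _) ?_ ?_
    · intro u
      split_ifs with h0
      · refine tendsto_finsetProd _ fun i _ => ?_
        have h1 := (tendsto_psiAv (u i)).mul_const (fcT (h i) (u i))
        rw [one_mul] at h1
        refine h1.congr fun N => ?_
        rw [(H i).fcT_regAv (hN0 N) (hN1 N)]
      · exact tendsto_const_nhds
    · refine Eventually.of_forall fun N u => ?_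
      split_ifs with h0
      · refine prod_bound_le m (fun i => fcT (regAv (1 / ((N : ℝ) + 1)) (h i))) K α ?_ u
        intro i t
        rw [(H i).fcT_regAv (hN0 N) (hN1 N), norm_mul]
        calc _ ≤ 1 * ‖fcT (h i) t‖ := by
              gcongr
              exact norm_psiAv_le_one (hN0 N) t
          _ ≤ _ := by rw [one_mul]; exact hb i t
      · simp
  have hL0 : Tendsto (fun N : ℕ => ∫ x in Ioc (-π) π, ∏ i, regAv (1 / ((N : ℝ) + 1)) (h i) x)
      atTop (𝓝 (∫ x in Ioc (-π) π, ∏ i, h i x)) := by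
    refine tendsto_integral_of_dominated_convergence
      (fun x => (∏ i, 18 * C₁ i / (1 - α i)) * |x| ^ (-∑ i, α i)) ?_ ?_ ?_ ?_
    · intro N
      exact (continuous_finsetProd _ fun i _ => (H i).regAv_continuous _).aestronglyMeasurable
    · exact ((abs_rpow_intervalIntegrable hαsum (-π) π).1).const_mul _
    · intro N
      rw [ae_restrict_iff' measurableSet_Ioc]
      filter_upwards [ae_ne_zero] with x hx0 hx
      rw [norm_prod, ← Finset.sum_neg_distrib, Real.rpow_sum_of_pos (abs_pos.2 hx0),
        ← Finset.prod_mul_distrib]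
      refine Finset.prod_le_prod (fun i _ => norm_nonneg _) fun i _ => ?_
      exact (H i).regAv_bound (hN0 N) (hN1 N) hx hx0
    · rw [ae_restrict_iff' measurableSet_Ioc]
      filter_upwards [ae_ne_zero] with x hx0 hx
      exact tendsto_finsetProd _ fun i _ => (H i).tendsto_regAv hx hx0
  have hL : Tendsto (fun N : ℕ => (((2 * π) ^ (m - 1) *
      ∫ x in Ioc (-π) π, ∏ i, regAv (1 / ((N : ℝ) + 1)) (h i) x : ℝ) : ℂ)) atTop
      (𝓝 (((2 * π) ^ (m - 1) * ∫ x in Ioc (-π) π, ∏ i, h i x : ℝ) : ℂ)) :=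
    (Complex.continuous_ofReal.tendsto _).comp (hL0.const_mul _)
  refine tendsto_nhds_unique hL ?_
  refine hR.congr fun N => ?_
  exact (hid N).symm

theorem stmt5 (m : ℕ) (hm : 2 ≤ m) (h : Fin m → ℝ → ℝ)
    (heven : ∀ i, ∀ x : ℝ, h i (-x) = h i x)
    (hper : ∀ i, Function.Periodic (h i) (2 * π))
    (α : Fin m → ℝ) (C₁ C₂ : Fin m → ℝ)
    (hα : ∀ i, 0 < α i ∧ α i < 1) (hαsum : ∑ i, α i < 1)
    (hC₁ : ∀ i, 0 < C₁ i) (hC₂ : ∀ i, 0 < C₂ i)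
    (hdiff : ∀ i, ∀ x ∈ Ioc (-π) π, x ≠ 0 → DifferentiableAt ℝ (h i) x)
    (hbound : ∀ i, ∀ x ∈ Ioc (-π) π, x ≠ 0 → |h i x| ≤ C₁ i * |x| ^ (-(α i)))
    (hbound' : ∀ i, ∀ x ∈ Ioc (-π) π, x ≠ 0 →
      |deriv (h i) x| ≤ C₂ i * |x| ^ (-(α i + 1))) :
    ∀ ε > (0 : ℝ),
      (fun n : ℕ => ΔB h n) =O[atTop]
        fun n : ℕ => (n : ℝ) ^ (-((1 - ∑ i, α i) / m) + ε) := by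
  intro ε hε
  have H : ∀ i, SymHyp (h i) (α i) (C₁ i) (C₂ i) := fun i =>
    ⟨heven i, hper i, (hα i).1, (hα i).2, hC₁ i, hC₂ i, hdiff i, hbound i, hbound' i⟩
  choose K hK hb using fun i => (H i).fcT_bound
  have hm0 : (0 : ℝ) < m := by
    have : 0 < m := by omega
    exact_mod_cast this
  have hm1 : (1 : ℝ) ≤ m := by
    have : 1 ≤ m := by omega
    exact_mod_cast this
  set γ : ℝ := (1 - ∑ i, α i) / m with hγ
  have hγ0 : 0 < γ := div_pos (by linarith) hm0
  have hsα : 0 ≤ ∑ i, α i := Finset.sum_nonneg fun i _ => (hα i).1.le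
  have hγ1 : γ ≤ 1 := by
    rw [hγ, div_le_one hm0]; linarith
  have hmγ : m * γ = 1 - ∑ i, α i := by
    rw [hγ]; field_simp
  obtain ⟨δ, hδ0, hδγ, hδε⟩ : ∃ δ : ℝ, 0 < δ ∧ δ < γ ∧ γ - ε ≤ δ := by
    refine ⟨γ - min ε (γ / 2), ?_, ?_, ?_⟩
    · have := min_le_right ε (γ / 2); linarith
    · have : 0 < min ε (γ / 2) := lt_min hε (by linarith)
      linarith
    · have := min_le_left ε (γ / 2); linarith
  have hsum : ∑ i, (α i + δ) < 1 := by
    rw [Finset.sum_add_distrib, Finset.sum_const, Finset.card_univ, Fintype.card_fin,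
      nsmul_eq_mul]
    nlinarith
  obtain ⟨M, hM⟩ := trace_rate m hm (fun i => fcT (h i)) K α hK (fun i => (hα i).1) δ hδ0
    (by linarith) hsum hb
  refine IsBigO.of_bound |M| ?_
  filter_upwards [eventually_ge_atTop 1] with n hn
  have h1 := hM n hn
  have hn1 : (1 : ℝ) ≤ n := by exact_mod_cast hn
  have h2 : ΔB h n ≤ M * (n : ℝ) ^ (-δ) := by
    unfold ΔB
    rw [product_formula_sym m hm h α C₁ C₂ H hαsum]
    exact h1
  have h3 : (n : ℝ) ^ (-δ) ≤ (n : ℝ) ^ (-γ + ε) :=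
    Real.rpow_le_rpow_of_exponent_le hn1 (by linarith)
  have h4 : 0 ≤ (n : ℝ) ^ (-δ) := by positivity
  have h5 : 0 ≤ ΔB h n := norm_nonneg _
  rw [Real.norm_eq_abs, Real.norm_eq_abs, abs_of_nonneg h5, abs_of_nonneg (h4.trans h3)]
  calc ΔB h n ≤ M * (n : ℝ) ^ (-δ) := h2
    _ ≤ |M| * (n : ℝ) ^ (-δ) := mul_le_mul_of_nonneg_right (le_abs_self M) h4
    _ ≤ _ := mul_le_mul_of_nonneg_left h3 (abs_nonneg M)
end
end

section
/- Let h₁, h₂ be even real functions on 𝕋 = (−π,π], differentiable on 𝕋\{0}, such that for some constants C_{1i}, C_{2i} > 0 and exponents α_i with 0 < α_i < 1 and α₁ + α₂ < 1 one has |h_i(λ)| ≤ C_{1i}|λ|^{−α_i} and |h_i′(λ)| ≤ C_{2i}|λ|^{−(α_i+1)} for all λ ∈ 𝕋\{0}, i = 1,2. Then Δ₂(T) := | (1/T)·tr[B_T(h₁)B_T(h₂)] − 2π ∫_{−π}^{π} h₁(λ)h₂(λ) dλ | = O(T^{−1+(α₁+α₂)}) as T → ∞. -/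
open MeasureTheory Filter Set Asymptotics Real
open scoped ENNReal Topology

noncomputable section

/-- The normalized-trace approximation error for a pair of Toeplitz matrices. -/
def Δ₂B (h₁ h₂ : ℝ → ℝ) (n : ℕ) : ℝ :=
  ‖(n : ℂ)⁻¹ * Matrix.trace (BT n h₁ * BT n h₂)
    - ((2 * π * ∫ x in Ioc (-π) π, h₁ x * h₂ x : ℝ) : ℂ)‖


/-- The hypotheses on one function, restricted to the half interval `(0, π]`. -/
structure GoodFn (h : ℝ → ℝ) (α A B : ℝ) : Prop where
  even : ∀ x, h (-x) = h x
  a0 : 0 < α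
  a1 : α < 1
  A0 : 0 < A
  B0 : 0 < B
  diff : ∀ x ∈ Ioc 0 π, DifferentiableAt ℝ h x
  bd : ∀ x ∈ Ioc 0 π, |h x| ≤ A * x ^ (-α)
  bd' : ∀ x ∈ Ioc 0 π, |deriv h x| ≤ B * x ^ (-α - 1)

/-- Half-interval (truncated) cosine coefficient. -/
def cco (h : ℝ → ℝ) (ε : ℝ) (t : ℤ) : ℝ := 2 * ∫ x in ε..π, Real.cos (t * x) * h x

lemma GoodFn.contOn {h : ℝ → ℝ} {α A B : ℝ} (H : GoodFn h α A B) : ContinuousOn h (Ioc 0 π) :=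
  fun x hx => (H.diff x hx).continuousAt.continuousWithinAt

lemma GoodFn.intble {h : ℝ → ℝ} {α A B : ℝ} (H : GoodFn h α A B) :
    IntervalIntegrable h volume 0 π := by
  have h1 : IntervalIntegrable (fun x : ℝ => A * x ^ (-α)) volume 0 π :=
    (intervalIntegral.intervalIntegrable_rpow' (by linarith [H.a1])).const_mul A
  rw [intervalIntegrable_iff_integrableOn_Ioc_of_le pi_pos.le] at h1 ⊢
  refine Integrable.mono' h1 (H.contOn.aestronglyMeasurable measurableSet_Ioc) ?_
  refine (ae_restrict_iff' measurableSet_Ioc).2 (Eventually.of_forall fun x hx => ?_)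
  exact H.bd x hx

lemma GoodFn.intble_sub {h : ℝ → ℝ} {α A B : ℝ} (H : GoodFn h α A B) {a b : ℝ}
    (ha : a ∈ Icc 0 π) (hb : b ∈ Icc 0 π) : IntervalIntegrable h volume a b := by
  refine H.intble.mono_set ?_
  rw [uIcc_of_le pi_pos.le]
  exact uIcc_subset_Icc ha hb

lemma GoodFn.intble_mul {h g : ℝ → ℝ} {α A B β A' B' : ℝ} (H : GoodFn h α A B)
    (G : GoodFn g β A' B') (hs : α + β < 1) :
    IntervalIntegrable (fun x => h x * g x) volume 0 π := by
  have h1 : IntervalIntegrable (fun x : ℝ => (A * A') * x ^ (-(α + β))) volume 0 π :=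
    (intervalIntegral.intervalIntegrable_rpow' (by linarith)).const_mul _
  rw [intervalIntegrable_iff_integrableOn_Ioc_of_le pi_pos.le] at h1 ⊢
  refine Integrable.mono' h1 ((H.contOn.mul G.contOn).aestronglyMeasurable measurableSet_Ioc) ?_
  refine (ae_restrict_iff' measurableSet_Ioc).2 (Eventually.of_forall fun x hx => ?_)
  have e : x ^ (-(α + β)) = x ^ (-α) * x ^ (-β) := by
    rw [← Real.rpow_add hx.1]; ring_nf
  rw [e, norm_mul]
  calc ‖h x‖ * ‖g x‖ ≤ (A * x ^ (-α)) * (A' * x ^ (-β)) :=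
        mul_le_mul (H.bd x hx) (G.bd x hx) (norm_nonneg _)
          (mul_nonneg H.A0.le (Real.rpow_nonneg hx.1.le _))
    _ = _ := by ring

lemma GoodFn.intble_cos {h : ℝ → ℝ} {α A B : ℝ} (H : GoodFn h α A B) (t : ℤ) {a b : ℝ}
    (ha : a ∈ Icc 0 π) (hb : b ∈ Icc 0 π) :
    IntervalIntegrable (fun x => Real.cos (t * x) * h x) volume a b :=
  (H.intble_sub ha hb).continuousOn_mul (by fun_prop)

/-- The part near zero. -/
lemma GoodFn.near {h : ℝ → ℝ} {α A B : ℝ} (H : GoodFn h α A B) (t : ℤ) {a b : ℝ}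
    (ha : 0 ≤ a) (hab : a ≤ b) (hb : b ≤ π) :
    |∫ x in a..b, Real.cos (t * x) * h x| ≤ A / (1 - α) * b ^ (1 - α) := by
  have h1 : IntervalIntegrable (fun x : ℝ => A * x ^ (-α)) volume a b :=
    (intervalIntegral.intervalIntegrable_rpow' (by linarith [H.a1])).const_mul A
  have := intervalIntegral.norm_integral_le_of_norm_le (f := fun x => Real.cos (t * x) * h x)
    hab (g := fun x => A * x ^ (-α)) (μ := volume)
    (Eventually.of_forall fun x hx => by
      rw [norm_mul]
      have h2 := H.bd x ⟨ha.trans_lt hx.1, hx.2.trans hb⟩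
      have h3 := Real.abs_cos_le_one (t * x)
      calc ‖Real.cos (t * x)‖ * ‖h x‖ ≤ 1 * ‖h x‖ :=
            mul_le_mul_of_nonneg_right h3 (norm_nonneg _)
        _ ≤ _ := by simpa using h2) h1
  refine this.trans ?_
  rw [intervalIntegral.integral_const_mul, integral_rpow (Or.inl (by linarith [H.a1]))]
  have e : -α + 1 = 1 - α := by ring
  rw [e, div_mul_eq_mul_div, mul_div_assoc]
  have h0 : 0 < 1 - α := by linarith [H.a1]
  have := Real.rpow_nonneg ha (1 - α)
  have := H.A0
  gcongr
  linarith

/-- The part away from zero. -/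
lemma GoodFn.far {h : ℝ → ℝ} {α A B : ℝ} (H : GoodFn h α A B) (t : ℕ) (ht : 0 < t) {a : ℝ}
    (ha : 0 < a) (hab : a ≤ π) :
    |∫ x in a..π, Real.cos ((t : ℤ) * x) * h x| ≤ (A + B / α) * a ^ (-α) / t := by
  have ht' : (0 : ℝ) < t := by exact_mod_cast ht
  have hsub : ∀ x ∈ uIcc a π, x ∈ Ioc 0 π := fun x hx => by
    rw [uIcc_of_le hab] at hx; exact ⟨ha.trans_le hx.1, hx.2⟩
  have hr : IntervalIntegrable (fun x : ℝ => B * x ^ (-α - 1)) volume a π := by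
    apply ContinuousOn.intervalIntegrable
    refine continuousOn_const.mul (continuousOn_id.rpow_const fun x hx => Or.inl (hsub x hx).1.ne')
  have hd : IntervalIntegrable (deriv h) volume a π := by
    rw [intervalIntegrable_iff_integrableOn_Ioc_of_le hab] at hr ⊢
    refine Integrable.mono' hr (measurable_deriv h).aestronglyMeasurable ?_
    refine (ae_restrict_iff' measurableSet_Ioc).2 (Eventually.of_forall fun x hx => ?_)
    exact H.bd' x ⟨ha.trans hx.1, hx.2⟩
  have hp := intervalIntegral.integral_mul_deriv_eq_deriv_mul (a := a) (b := π) (u := h)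
    (u' := deriv h) (v := fun x => Real.sin (t * x) / t) (v' := fun x => Real.cos (t * x))
    (fun x hx => (H.diff x (hsub x hx)).hasDerivAt)
    (fun x hx => by
      have h1 : HasDerivAt (fun x : ℝ => (t : ℝ) * x) t x := by
        simpa using (hasDerivAt_id x).const_mul (t : ℝ)
      have := (h1.sin).div_const (t : ℝ)
      convert this using 1
      field_simp) hd
    (Continuous.intervalIntegrable (by fun_prop) _ _)
  have e : (∫ x in a..π, Real.cos ((t : ℤ) * x) * h x) = ∫ x in a..π, h x * Real.cos (t * x) := by
    congr 1; ext x; push_cast; ring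
  rw [e, hp, Real.sin_nat_mul_pi]
  have h3 : |∫ x in a..π, deriv h x * (Real.sin (t * x) / t)| ≤ B / α * a ^ (-α) / t := by
    have := intervalIntegral.norm_integral_le_of_norm_le
      (f := fun x => deriv h x * (Real.sin (t * x) / t))
      hab (g := fun x => B * x ^ (-α - 1) * (1 / t)) (μ := volume)
      (Eventually.of_forall fun x hx => by
        rw [norm_mul, norm_div]
        have h2 := H.bd' x ⟨ha.trans hx.1, hx.2⟩
        have h3 := Real.abs_sin_le_one (t * x)
        have h4 : ‖(t : ℝ)‖ = t := by simp
        rw [h4]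
        refine mul_le_mul h2 ?_ (by positivity) ((abs_nonneg _).trans h2)
        exact div_le_div_of_nonneg_right h3 ht'.le) (hr.mul_const _)
    refine this.trans ?_
    rw [intervalIntegral.integral_mul_const, intervalIntegral.integral_const_mul, integral_rpow]
    · have e : -α - 1 + 1 = -α := by ring
      rw [e]
      have := H.a0
      have := H.B0
      have := Real.rpow_nonneg pi_pos.le (-α)
      have : B * ((π ^ (-α) - a ^ (-α)) / -α) = B / α * a ^ (-α) - B / α * π ^ (-α) := by
        field_simp; ring
      rw [this, mul_one_div]
      gcongr
      have : 0 ≤ B / α * π ^ (-α) := by positivity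
      linarith
    · right
      refine ⟨by linarith [H.a0], fun h0 => lt_irrefl _ (hsub 0 h0).1⟩
  have h4 : |h a * (Real.sin (t * a) / t)| ≤ A * a ^ (-α) / t := by
    have h2 := H.bd a ⟨ha, hab⟩
    have h3 := Real.abs_sin_le_one (t * a)
    rw [abs_mul, abs_div, abs_of_pos ht', ← mul_div_assoc]
    refine div_le_div_of_nonneg_right ?_ ht'.le
    calc |h a| * |Real.sin (t * a)| ≤ |h a| * 1 := by gcongr
      _ ≤ _ := by simpa using h2
  have e2 : (A + B / α) * a ^ (-α) / t = A * a ^ (-α) / t + B / α * a ^ (-α) / t := by ring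
  rw [e2]
  have := abs_sub (h π * (0 / (t : ℝ)) - h a * (Real.sin (t * a) / t)) (∫ x in a..π, deriv h x * (Real.sin (t * x) / t))
  refine this.trans (add_le_add ?_ h3)
  simpa using h4

lemma GoodFn.decay {h : ℝ → ℝ} {α A B : ℝ} (H : GoodFn h α A B) : ∃ K : ℝ, 0 < K ∧
    (∀ ε ∈ Icc 0 π, |cco h ε 0| ≤ K) ∧
    ∀ ε ∈ Icc 0 π, ∀ t : ℤ, t ≠ 0 → |cco h ε t| ≤ K * |(t : ℝ)| ^ (α - 1) := by
  have h0 : 0 < 1 - α := by linarith [H.a1]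
  have hA := H.A0
  have hB := H.B0
  have ha := H.a0
  have hpi := pi_pos
  set K1 := A / (1 - α) * π ^ (1 - α)
  set K2 := A / (1 - α) + (A + B / α)
  have k1 : 0 < K1 := by positivity
  have k2 : 0 < K2 := by positivity
  refine ⟨2 * (K1 + K2), by positivity, fun ε hε => ?_, fun ε hε t ht => ?_⟩
  · have := H.near 0 hε.1 hε.2 le_rfl
    rw [cco, abs_mul, abs_of_pos two_pos]
    gcongr
    exact this.trans (by linarith)
  · have key : ∀ n : ℕ, 0 < n → |∫ x in ε..π, Real.cos ((n : ℤ) * x) * h x| ≤ K2 * (n : ℝ) ^ (α - 1) := by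
      intro n hn
      have hn' : (1 : ℝ) ≤ n := by exact_mod_cast hn
      have hn0 : (0 : ℝ) < n := by linarith
      set δ := max ε (1 / (n : ℝ))
      have hi : 1 / (n : ℝ) ≤ π := by
        have : 1 / (n : ℝ) ≤ 1 := by rw [div_le_one hn0]; exact hn'
        linarith [Real.pi_gt_three]
      have hi0 : 0 < 1 / (n : ℝ) := by positivity
      have hδ0 : 0 < δ := lt_max_of_lt_right hi0
      have hδ : δ ≤ π := max_le hε.2 hi
      have hsp := intervalIntegral.integral_add_adjacent_intervals
        (H.intble_cos n hε ⟨hδ0.le, hδ⟩) (H.intble_cos n ⟨hδ0.le, hδ⟩ ⟨hpi.le, le_rfl⟩)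
      rw [← hsp]
      refine (abs_add_le _ _).trans ?_
      have e1 : (1 / (n : ℝ)) ^ (1 - α) = (n : ℝ) ^ (α - 1) := by
        rw [one_div, Real.inv_rpow hn0.le, ← Real.rpow_neg hn0.le]; ring_nf
      have p1 : |∫ x in ε..δ, Real.cos ((n : ℤ) * x) * h x| ≤ A / (1 - α) * (n : ℝ) ^ (α - 1) := by
        rcases le_total (1 / (n : ℝ)) ε with hle | hle
        · have : δ = ε := max_eq_left hle
          rw [this]; simp only [intervalIntegral.integral_same, abs_zero]; positivity
        · have e : δ = 1 / (n : ℝ) := max_eq_right hle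
          have := H.near n hε.1 (le_max_left _ _ : ε ≤ δ) hδ
          rw [max_eq_right hle] at this
          rw [← e1, e]; exact this
      have p2 := H.far n hn hδ0 hδ
      have p3 : δ ^ (-α) ≤ (n : ℝ) ^ α := by
        have : δ ^ (-α) ≤ (1 / (n : ℝ)) ^ (-α) :=
          Real.rpow_le_rpow_of_nonpos hi0 (le_max_right _ _) (by linarith)
        rwa [one_div, Real.inv_rpow hn0.le, ← Real.rpow_neg hn0.le, neg_neg] at this
      have p4 : (A + B / α) * δ ^ (-α) / n ≤ (A + B / α) * (n : ℝ) ^ (α - 1) := by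
        rw [Real.rpow_sub_one hn0.ne', ← mul_div_assoc]
        gcongr
      have : K2 * (n : ℝ) ^ (α - 1) = A / (1 - α) * (n : ℝ) ^ (α - 1) + (A + B / α) * (n : ℝ) ^ (α - 1) := by ring
      rw [this]
      exact add_le_add p1 (p2.trans p4)
    have hn : 0 < t.natAbs := Int.natAbs_pos.2 ht
    have := key t.natAbs hn
    have e3 : ((t.natAbs : ℕ) : ℝ) = |(t : ℝ)| := by
      rw [Nat.cast_natAbs]; push_cast; rfl
    have e4 : ∀ x : ℝ, Real.cos (((t.natAbs : ℕ) : ℤ) * x) = Real.cos (t * x) := by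
      intro x
      rcases Int.natAbs_eq t with h | h
      · conv_rhs => rw [h]
      · conv_rhs => rw [h]
        push_cast
        rw [neg_mul, Real.cos_neg]
    simp only [e4, e3] at this
    rw [cco, abs_mul, abs_of_pos two_pos]
    have hp : 0 ≤ |(t : ℝ)| ^ (α - 1) := by positivity
    calc _ ≤ 2 * (K2 * |(t : ℝ)| ^ (α - 1)) := by gcongr
      _ ≤ _ := by nlinarith [mul_nonneg k1.le hp]

/-- Fourier integrals of even functions. -/
lemma even_fourier (g : ℝ → ℝ) (hg : ∀ x, g (-x) = g x) (hi : IntervalIntegrable g volume 0 π)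
    (t : ℤ) :
    ∫ x in (-π)..π, Complex.exp (Complex.I * x * t) * (g x : ℂ) = ((cco g 0 t : ℝ) : ℂ) := by
  set F : ℝ → ℂ := fun x => Complex.exp (Complex.I * x * t) * (g x : ℂ) with hF
  have hi' : IntervalIntegrable (fun x => (g x : ℂ)) volume 0 π := by
    rw [intervalIntegrable_iff] at hi ⊢
    exact hi.ofReal
  have hF1 : IntervalIntegrable F volume 0 π := hi'.continuousOn_mul (by fun_prop)
  have hF2 : IntervalIntegrable (fun x => F (-x)) volume 0 π := by
    have : (fun x => F (-x)) = fun x : ℝ =>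
        Complex.exp (Complex.I * (-x : ℝ) * t) * (g x : ℂ) := by
      ext x; simp only [hF, hg]
    rw [this]
    exact hi'.continuousOn_mul (by fun_prop)
  have hF3 : IntervalIntegrable F volume (-π) 0 := by
    have := (IntervalIntegrable.iff_comp_neg (f := F) (a := 0) (b := -π) ).2 (by simpa using hF2)
    exact this.symm
  have e1 : (∫ x in (-π)..0, F x) = ∫ x in (0 : ℝ)..π, F (-x) := by
    rw [intervalIntegral.integral_comp_neg]; simp
  rw [← intervalIntegral.integral_add_adjacent_intervals hF3 hF1, e1,
    ← intervalIntegral.integral_add hF2 hF1, cco]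
  rw [← intervalIntegral.integral_const_mul, ← intervalIntegral.integral_ofReal]
  congr 1
  ext x
  simp only [hF, hg]
  push_cast
  rw [Complex.cos]
  have a1 : Complex.I * -(x : ℂ) * t = -(t * x) * Complex.I := by ring
  have a2 : Complex.I * (x : ℂ) * t = (t * x) * Complex.I := by ring
  rw [a1, a2]
  ring

lemma even_int (g : ℝ → ℝ) (hg : ∀ x, g (-x) = g x) (hi : IntervalIntegrable g volume 0 π) :
    ∫ x in (-π)..π, g x = 2 * ∫ x in (0 : ℝ)..π, g x := by
  have := even_fourier g hg hi 0
  simp only [cco, Int.cast_zero, mul_zero, Complex.exp_zero, one_mul, zero_mul, Real.cos_zero] at this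
  rw [intervalIntegral.integral_ofReal] at this
  exact_mod_cast this

lemma parseval_sq (g : ℝ → ℝ) (hg : ∀ x, g (-x) = g x) {M : ℝ}
    (hm : AEStronglyMeasurable g (volume.restrict (Ioc (-π) π)))
    (hb : ∀ x ∈ Ioc (-π) π, |g x| ≤ M) :
    HasSum (fun t : ℤ => cco g 0 t ^ 2) (2 * π * (2 * ∫ x in (0 : ℝ)..π, g x ^ 2)) := by
  have hpi := pi_pos
  have hab : -π < π := by linarith
  have hL : ∀ p, MemLp g p (volume.restrict (Ioc (-π) π)) := fun p =>
    MemLp.of_bound hm M ((ae_restrict_iff' measurableSet_Ioc).2 (Eventually.of_forall hb))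
  have hi : IntervalIntegrable g volume 0 π := by
    rw [intervalIntegrable_iff_integrableOn_Ioc_of_le hpi.le]
    have : IntegrableOn g (Ioc (-π) π) := memLp_one_iff_integrable.1 (hL 1)
    exact this.mono_set (Ioc_subset_Ioc_left (by linarith))
  have hi2 : IntervalIntegrable (fun x => g x ^ 2) volume 0 π := by
    rw [intervalIntegrable_iff_integrableOn_Ioc_of_le hpi.le]
    have : IntegrableOn (fun x => g x ^ 2) (Ioc (-π) π) := (hL 2).integrable_sq
    exact this.mono_set (Ioc_subset_Ioc_left (by linarith))
  have hP := hasSum_sq_fourierCoeffOn (f := fun x => (g x : ℂ)) hab (hL 2).ofReal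
  have hc : ∀ t : ℤ, ‖fourierCoeffOn hab (fun x => (g x : ℂ)) t‖ ^ 2
      = (1 / (2 * π)) ^ 2 * cco g 0 t ^ 2 := by
    intro t
    have e : fourierCoeffOn hab (fun x => (g x : ℂ)) t = ((1 / (2 * π) * cco g 0 (-t) : ℝ) : ℂ) := by
      rw [fourierCoeffOn_eq_integral]
      push_cast
      rw [← even_fourier g hg hi]
      rw [Complex.real_smul]
      congr 1
      · push_cast; ring
      · congr 1
        ext x
        rw [fourier_coe_apply, smul_eq_mul]
        congr 2
        push_cast
        have : (π : ℂ) ≠ 0 := by exact_mod_cast hpi.ne'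
        field_simp
        ring
    have e2 : cco g 0 (-t) = cco g 0 t := by
      simp [cco]
    rw [e, e2, Complex.norm_real, Real.norm_eq_abs, sq_abs, mul_pow]
  simp only [hc] at hP
  have h2 := hP.mul_left ((2 * π) ^ 2)
  have e3 : (fun x : ℝ => ‖(g x : ℂ)‖ ^ 2) = fun x => g x ^ 2 := by
    ext x; rw [Complex.norm_real, Real.norm_eq_abs, sq_abs]
  rw [e3, even_int (fun x => g x ^ 2) (fun x => by simp only [hg]) hi2] at h2
  have E1 : (fun t : ℤ => cco g 0 t ^ 2)
      = fun t => (2 * π) ^ 2 * ((1 / (2 * π)) ^ 2 * cco g 0 t ^ 2) := by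
    ext t; field_simp
  have E2 : 2 * π * (2 * ∫ x in (0 : ℝ)..π, g x ^ 2)
      = (2 * π) ^ 2 * (π - -π)⁻¹ • (2 * ∫ x in (0 : ℝ)..π, g x ^ 2) := by
    have e : π - -π = 2 * π := by ring
    rw [smul_eq_mul, e]; field_simp
  rw [E1, E2]
  exact h2

/-- Truncation away from the origin. -/
def trunc (h : ℝ → ℝ) (ε : ℝ) : ℝ → ℝ := fun x => if ε < |x| then h x else 0

lemma trunc_integral (h F : ℝ → ℝ) {ε : ℝ} (h0 : 0 ≤ ε) (h1 : ε ≤ π) :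
    ∫ x in (0 : ℝ)..π, F x * trunc h ε x = ∫ x in ε..π, F x * h x := by
  rw [intervalIntegral.integral_of_le pi_pos.le, intervalIntegral.integral_of_le h1]
  have : ∀ x ∈ Ioc (0 : ℝ) π, F x * trunc h ε x = (Ioc ε π).indicator (fun x => F x * h x) x := by
    intro x hx
    by_cases hh : ε < x
    · simp [trunc, abs_of_pos hx.1, hh, Set.indicator, hx.2]
    · simp [trunc, abs_of_pos hx.1, hh, Set.indicator]
  rw [setIntegral_congr_fun measurableSet_Ioc this, setIntegral_indicator measurableSet_Ioc]
  congr 2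
  ext x
  simp only [mem_inter_iff, mem_Ioc]
  constructor
  · tauto
  · rintro ⟨a, b⟩; exact ⟨⟨h0.trans_lt a, b⟩, a, b⟩

lemma GoodFn.abs_bd {h : ℝ → ℝ} {α A B : ℝ} (H : GoodFn h α A B) {ε : ℝ} (h0 : 0 < ε) (x : ℝ)
    (hx : x ∈ Icc (-π) π) : |trunc h ε x| ≤ A * ε ^ (-α) := by
  have hA := H.A0
  unfold trunc
  split_ifs with hh
  · have e : h x = h |x| := by
      rcases abs_choice x with h | h <;> rw [h]
      rw [H.even]
    rw [e]
    refine (H.bd |x| ⟨h0.trans hh, abs_le.2 hx⟩).trans ?_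
    gcongr ?_ * ?_
    exact Real.rpow_le_rpow_of_nonpos h0 hh.le (by linarith [H.a0])
  · simp; positivity

lemma GoodFn.trunc_meas {h : ℝ → ℝ} {α A B : ℝ} (H : GoodFn h α A B) {ε : ℝ} (h0 : 0 < ε) :
    AEStronglyMeasurable (trunc h ε) (volume.restrict (Ioc (-π) π)) := by
  have hS : MeasurableSet {x : ℝ | ε < |x|} := measurableSet_lt measurable_const (by fun_prop)
  have e : trunc h ε = {x : ℝ | ε < |x|}.indicator h := by
    ext x; simp [trunc, Set.indicator]
  rw [e, aestronglyMeasurable_indicator_iff hS, Measure.restrict_restrict hS]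
  refine ContinuousOn.aestronglyMeasurable (fun x hx => ?_) (hS.inter measurableSet_Ioc)
  apply ContinuousAt.continuousWithinAt
  obtain ⟨hx1, hx2, hx3⟩ := hx
  simp only [mem_ofPred_eq] at hx1
  rcases le_total 0 x with hp | hp
  · rw [abs_of_nonneg hp] at hx1
    exact (H.diff x ⟨h0.trans hx1, hx3⟩).continuousAt
  · rw [abs_of_nonpos hp] at hx1
    have := (H.diff (-x) ⟨h0.trans hx1, by linarith⟩).continuousAt
    have h2 : ContinuousAt (fun y => h (-y)) x := this.comp (f := fun y : ℝ => -y) continuousAt_neg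
    simpa only [H.even] using h2

lemma parseval_trunc {h g : ℝ → ℝ} {α A B β A' B' : ℝ} (H : GoodFn h α A B)
    (G : GoodFn g β A' B') {ε : ℝ} (h0 : 0 < ε) (h1 : ε ≤ π) :
    HasSum (fun t : ℤ => cco h ε t * cco g ε t) (2 * π * (2 * ∫ x in ε..π, h x * g x)) := by
  have hpi := pi_pos
  have hc : ∀ (h : ℝ → ℝ) t, cco (trunc h ε) 0 t = cco h ε t := fun h t => by
    unfold cco; rw [trunc_integral h _ h0.le h1]
  have ev : ∀ h : ℝ → ℝ, (∀ x, h (-x) = h x) → ∀ x, trunc h ε (-x) = trunc h ε x := by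
    intro h hh x; simp [trunc, hh]
  set u := trunc h ε with hu
  set v := trunc g ε with hv
  have um := H.trunc_meas h0
  have vm := G.trunc_meas h0
  rw [← hu] at um
  rw [← hv] at vm
  have ub : ∀ x ∈ Ioc (-π) π, |u x| ≤ A * ε ^ (-α) := fun x hx => H.abs_bd h0 x ⟨hx.1.le, hx.2⟩
  have vb : ∀ x ∈ Ioc (-π) π, |v x| ≤ A' * ε ^ (-β) := fun x hx => G.abs_bd h0 x ⟨hx.1.le, hx.2⟩
  have ue := ev h H.even
  have ve := ev g G.even
  have P1 := parseval_sq (fun x => u x + v x) (fun x => by simp only [hu, hv, ue, ve])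
    (um.add vm) (fun x hx => (abs_add_le _ _).trans (add_le_add (ub x hx) (vb x hx)))
  have P2 := parseval_sq (fun x => u x - v x) (fun x => by simp only [hu, hv, ue, ve])
    (um.sub vm) (fun x hx => (abs_sub _ _).trans (add_le_add (ub x hx) (vb x hx)))
  have ibd : ∀ (f : ℝ → ℝ) (M : ℝ), AEStronglyMeasurable f (volume.restrict (Ioc (-π) π)) →
      (∀ x ∈ Ioc (-π) π, |f x| ≤ M) → IntervalIntegrable f volume 0 π := by
    intro f M hm hb
    have : MemLp f 1 (volume.restrict (Ioc (-π) π)) :=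
      MemLp.of_bound hm M ((ae_restrict_iff' measurableSet_Ioc).2 (Eventually.of_forall hb))
    rw [intervalIntegrable_iff_integrableOn_Ioc_of_le hpi.le]
    have : IntegrableOn f (Ioc (-π) π) := memLp_one_iff_integrable.1 this
    exact this.mono_set (Ioc_subset_Ioc_left (by linarith))
  have ui := ibd u _ um ub
  have vi := ibd v _ vm vb
  have s1 : ∀ t, cco (fun x => u x + v x) 0 t = cco h ε t + cco g ε t := by
    intro t
    rw [← hc h t, ← hc g t, ← hu, ← hv]
    unfold cco
    rw [← mul_add, ← intervalIntegral.integral_add (ui.continuousOn_mul (by fun_prop))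
      (vi.continuousOn_mul (by fun_prop))]
    simp only [mul_add]
  have s2 : ∀ t, cco (fun x => u x - v x) 0 t = cco h ε t - cco g ε t := by
    intro t
    rw [← hc h t, ← hc g t, ← hu, ← hv]
    unfold cco
    rw [← mul_sub, ← intervalIntegral.integral_sub (ui.continuousOn_mul (by fun_prop))
      (vi.continuousOn_mul (by fun_prop))]
    simp only [mul_sub]
  have P := (P1.sub P2).mul_left (1 / 4)
  simp only [s1, s2] at P
  have sqi : ∀ (f : ℝ → ℝ) (M : ℝ), AEStronglyMeasurable f (volume.restrict (Ioc (-π) π)) →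
      (∀ x ∈ Ioc (-π) π, |f x| ≤ M) → IntervalIntegrable (fun x => f x ^ 2) volume 0 π := by
    intro f M hm hb
    refine ibd _ (M ^ 2) (hm.pow 2) (fun x hx => ?_)
    rw [abs_pow]
    exact pow_le_pow_left₀ (abs_nonneg _) (hb x hx) 2
  have i1 := sqi (fun x => u x + v x) _ (um.add vm)
    (fun x hx => (abs_add_le _ _).trans (add_le_add (ub x hx) (vb x hx)))
  have i2 := sqi (fun x => u x - v x) _ (um.sub vm)
    (fun x hx => (abs_sub _ _).trans (add_le_add (ub x hx) (vb x hx)))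
  have I : (∫ x in ε..π, h x * g x) = (1 / 4) * ((∫ x in (0:ℝ)..π, (u x + v x) ^ 2)
      - ∫ x in (0:ℝ)..π, (u x - v x) ^ 2) := by
    rw [← intervalIntegral.integral_sub i1 i2, ← intervalIntegral.integral_const_mul,
      ← trunc_integral g h h0.le h1]
    congr 1
    ext x
    by_cases hh : ε < |x|
    · simp [hu, hv, trunc, hh]; ring
    · simp [hu, hv, trunc, hh]
  have E1 : (fun t : ℤ => cco h ε t * cco g ε t)
      = fun t => 1 / 4 * ((cco h ε t + cco g ε t) ^ 2 - (cco h ε t - cco g ε t) ^ 2) := by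
    ext t; ring
  have E2 : 2 * π * (2 * ∫ x in ε..π, h x * g x)
      = 1 / 4 * (2 * π * (2 * ∫ x in (0:ℝ)..π, (u x + v x) ^ 2)
        - 2 * π * (2 * ∫ x in (0:ℝ)..π, (u x - v x) ^ 2)) := by
    rw [I]; ring
  rw [E1, E2]
  exact P

lemma cco_tendsto {h : ℝ → ℝ} (hi : IntervalIntegrable h volume 0 π) :
    Tendsto (fun ε => ∫ x in ε..π, h x) (𝓝[>] 0) (𝓝 (∫ x in (0 : ℝ)..π, h x)) := by
  have h1 : IntegrableOn h (uIcc 0 π) := by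
    rw [uIcc_of_le pi_pos.le, integrableOn_Icc_iff_integrableOn_Ioc]
    rwa [intervalIntegrable_iff_integrableOn_Ioc_of_le pi_pos.le] at hi
  have h2 := intervalIntegral.continuousOn_primitive_interval_left h1 0 left_mem_uIcc
  refine h2.tendsto.mono_left ?_
  rw [uIcc_of_le pi_pos.le, ← nhdsWithin_Ioo_eq_nhdsGT pi_pos]
  exact nhdsWithin_mono _ Ioo_subset_Icc_self

lemma prod_bound {h g : ℝ → ℝ} {α A B β A' B' : ℝ} (H : GoodFn h α A B)
    (G : GoodFn g β A' B') : ∃ K, 0 < K ∧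
    (∀ ε ∈ Icc 0 π, |cco h ε 0 * cco g ε 0| ≤ K) ∧
    ∀ ε ∈ Icc 0 π, ∀ t : ℤ, t ≠ 0 →
      |cco h ε t * cco g ε t| ≤ K * |(t : ℝ)| ^ (-(2 - (α + β))) := by
  obtain ⟨K, k0, k1, k2⟩ := H.decay
  obtain ⟨L, l0, l1, l2⟩ := G.decay
  refine ⟨K * L, by positivity, fun ε hε => ?_, fun ε hε t ht => ?_⟩
  · rw [abs_mul]
    exact mul_le_mul (k1 ε hε) (l1 ε hε) (abs_nonneg _) k0.le
  · rw [abs_mul]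
    have ht' : 0 < |(t : ℝ)| := by positivity
    have e : -(2 - (α + β)) = (α - 1) + (β - 1) := by ring
    rw [e, Real.rpow_add ht']
    calc _ ≤ (K * |(t : ℝ)| ^ (α - 1)) * (L * |(t : ℝ)| ^ (β - 1)) :=
          mul_le_mul (k2 ε hε t ht) (l2 ε hε t ht) (abs_nonneg _) (by positivity)
      _ = _ := by ring

lemma parseval_full {h g : ℝ → ℝ} {α A B β A' B' : ℝ} (H : GoodFn h α A B)
    (G : GoodFn g β A' B') (hs : α + β < 1) :
    HasSum (fun t : ℤ => cco h 0 t * cco g 0 t) (2 * π * (2 * ∫ x in (0:ℝ)..π, h x * g x)) := by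
  have hpi := pi_pos
  obtain ⟨K, k0, k1, k2⟩ := prod_bound H G
  set bd : ℤ → ℝ := fun t => K * |(t : ℝ)| ^ (-(2 - (α + β))) + if t = 0 then K else 0 with hbd
  have hsum : Summable bd := by
    refine ((Real.summable_abs_int_rpow (by linarith)).mul_left K).add ?_
    exact (hasSum_ite_eq 0 K).summable
  have hle : ∀ ε ∈ Icc 0 π, ∀ t, ‖cco h ε t * cco g ε t‖ ≤ bd t := by
    intro ε hε t
    by_cases ht : t = 0
    · subst ht
      have := k1 ε hε
      have h2 : 0 ≤ K * |((0 : ℤ) : ℝ)| ^ (-(2 - (α + β))) := by positivity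
      simp only [hbd, if_true, Real.norm_eq_abs]
      linarith
    · simpa [hbd, ht] using k2 ε hε t ht
  have hpt : ∀ t : ℤ, Tendsto (fun ε => cco h ε t * cco g ε t) (𝓝[>] 0)
      (𝓝 (cco h 0 t * cco g 0 t)) := by
    intro t
    refine Tendsto.mul ?_ ?_
    · exact (cco_tendsto (H.intble_cos t ⟨le_rfl, hpi.le⟩ ⟨hpi.le, le_rfl⟩)).const_mul 2
    · exact (cco_tendsto (G.intble_cos t ⟨le_rfl, hpi.le⟩ ⟨hpi.le, le_rfl⟩)).const_mul 2
  have hev : ∀ᶠ ε in 𝓝[>] (0 : ℝ), ε ∈ Ioo 0 π := Ioo_mem_nhdsGT hpi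
  have T1 := tendsto_tsum_of_dominated_convergence hsum hpt
    (hev.mono fun ε hε => hle ε ⟨hε.1.le, hε.2.le⟩)
  have T2 : Tendsto (fun ε => 2 * π * (2 * ∫ x in ε..π, h x * g x)) (𝓝[>] 0)
      (𝓝 (2 * π * (2 * ∫ x in (0:ℝ)..π, h x * g x))) :=
    ((cco_tendsto (H.intble_mul G hs)).const_mul 2).const_mul _
  have T3 := T2.congr' (hev.mono fun ε hε => (parseval_trunc H G hε.1 hε.2.le).tsum_eq.symm)
  have hE := tendsto_nhds_unique T1 T3
  rw [← hE]
  exact (Summable.of_norm_bounded hsum (hle 0 ⟨le_rfl, hpi.le⟩)).hasSum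

lemma bern {p x : ℝ} (hp0 : 0 ≤ p) (hp1 : p ≤ 1) (hx : 0 ≤ x) :
    x ^ p ≤ (x + 1) ^ p - p * (x + 1) ^ (p - 1) := by
  have h1 : 0 < x + 1 := by linarith
  have := rpow_one_add_le_one_add_mul_self (s := -(1 / (x + 1)))
    (by rw [neg_le_neg_iff, div_le_one h1]; linarith) hp0 hp1
  have e : 1 + -(1 / (x + 1)) = x / (x + 1) := by field_simp; ring
  rw [e, Real.div_rpow hx h1.le, div_le_iff₀ (by positivity)] at this
  rw [Real.rpow_sub_one h1.ne']
  calc _ ≤ _ := this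
    _ = _ := by field_simp; ring

lemma bern_neg {γ x : ℝ} (h0 : 0 < γ) (h1 : γ ≤ 1) (hx : 1 ≤ x) :
    x ^ (-(1 + γ)) ≤ 2 / γ * (x ^ (-γ) - (x + 1) ^ (-γ)) := by
  have hx0 : 0 < x := by linarith
  have hx1 : 0 < x + 1 := by linarith
  have b := bern h0.le h1 hx0.le
  rw [Real.rpow_sub_one hx1.ne'] at b
  have e : x ^ (-(1 + γ)) = (x * x ^ γ)⁻¹ := by
    rw [Real.rpow_neg hx0.le, Real.rpow_add hx0, Real.rpow_one]
  rw [e, Real.rpow_neg hx0.le, Real.rpow_neg hx1.le]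
  have u0 : 0 < x ^ γ := by positivity
  have v0 : 0 < (x + 1) ^ γ := by positivity
  set u := x ^ γ
  set v := (x + 1) ^ γ
  have e2 : 2 / γ * (u⁻¹ - v⁻¹) = 2 / γ * ((v - u) / (u * v)) := by field_simp
  rw [e2]
  have : γ * (v / (x + 1)) ≤ v - u := by linarith
  calc (x * u)⁻¹ ≤ 2 / γ * ((γ * (v / (x + 1))) / (u * v)) := by
        have : 2 / γ * ((γ * (v / (x + 1))) / (u * v)) = 2 / ((x + 1) * u) := by field_simp
        rw [this, inv_eq_one_div, div_le_div_iff₀ (by positivity) (by positivity)]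
        nlinarith
    _ ≤ _ := by gcongr

lemma sum_pow_le {β : ℝ} (h0 : 0 < β) (h1 : β < 1) (n : ℕ) :
    ∑ s ∈ Finset.range n, ((s : ℝ) + 1) ^ (β - 1) ≤ (n : ℝ) ^ β / β := by
  induction n with
  | zero => simp [Real.zero_rpow h0.ne']
  | succ n ih =>
    rw [Finset.sum_range_succ]
    have := bern h0.le h1.le (Nat.cast_nonneg n : (0 : ℝ) ≤ n)
    push_cast
    rw [le_div_iff₀ h0] at ih ⊢
    nlinarith

lemma row_sum (p : ℤ → ℝ) (hp : ∀ t, p (-t) = p t) (s r : ℕ) :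
    ∑ t ∈ Finset.range (s + 1 + r), p ((s : ℤ) - t)
      = p 0 + ∑ j ∈ Finset.range s, p ((j : ℤ) + 1) + ∑ j ∈ Finset.range r, p ((j : ℤ) + 1) := by
  induction r with
  | zero =>
    rw [add_zero, ← Finset.sum_range_reflect]
    have : ∀ j ∈ Finset.range (s + 1), p ((s : ℤ) - ((s + 1 - 1 - j : ℕ) : ℤ)) = p j := by
      intro j hj
      rw [Finset.mem_range] at hj
      congr 1
      omega
    rw [Finset.sum_congr rfl this, Finset.sum_range_succ']
    push_cast
    simp [add_comm]
  | succ r ih =>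
    rw [← add_assoc, Finset.sum_range_succ, ih, Finset.sum_range_succ]
    have : p ((s : ℤ) - ((s + 1 + r : ℕ) : ℤ)) = p ((r : ℤ) + 1) := by
      rw [← hp]; congr 1; push_cast; ring
    rw [this]; ring

lemma toeplitz_sum (p : ℤ → ℝ) (hp : ∀ t, p (-t) = p t) {S K β : ℝ} (hS : HasSum p S)
    (h0 : 0 < β) (h1 : β < 1) (hK : 0 < K)
    (hb : ∀ t : ℤ, t ≠ 0 → |p t| ≤ K * |(t : ℝ)| ^ (-(2 - β))) (n : ℕ) (hn : 0 < n) :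
    |(n : ℝ)⁻¹ * ∑ s ∈ Finset.range n, ∑ t ∈ Finset.range n, p ((s : ℤ) - t) - S|
      ≤ (4 * K / ((1 - β) * β)) * (n : ℝ) ^ (-1 + β) := by
  have hγ : 0 < 1 - β := by linarith
  have hn0 : (0 : ℝ) < n := by exact_mod_cast hn
  set q : ℕ → ℝ := fun j => p ((j : ℤ) + 1) with hq
  have hqs : Summable q := by
    refine hS.summable.comp_injective (i := fun j : ℕ => (j : ℤ) + 1) ?_
    intro a b hab
    simpa using hab
  have hQ := hqs.hasSum
  set Q := ∑' j, q j
  have hSQ : S = p 0 + Q + Q := by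
    have a1 : HasSum (fun n : ℕ => p n) (p 0 + Q) := by
      rw [← hasSum_nat_add_iff' 1]
      simpa using hQ
    have a2 : HasSum (fun n : ℕ => p (-((n : ℤ) + 1))) Q := by
      simpa only [hp] using hQ
    exact hS.unique (a1.of_nat_of_neg_add_one a2)
  set L := 2 * K / (1 - β) with hL
  have hL0 : 0 < L := by positivity
  have hqb : ∀ j : ℕ, |q j| ≤ L * (((j : ℝ) + 1) ^ (β - 1) - ((j : ℝ) + 1 + 1) ^ (β - 1)) := by
    intro j
    have b1 := hb ((j : ℤ) + 1) (by omega)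
    have j0 : (0 : ℝ) ≤ j := Nat.cast_nonneg j
    have b2 := bern_neg hγ (by linarith) (by linarith : (1 : ℝ) ≤ (j : ℝ) + 1)
    push_cast at b1
    rw [abs_of_pos (by linarith : (0 : ℝ) < (j : ℝ) + 1)] at b1
    have e1 : -(2 - β) = -(1 + (1 - β)) := by ring
    have e2 : -(1 - β) = β - 1 := by ring
    rw [e1] at b1
    rw [e2] at b2
    refine b1.trans ?_
    calc _ ≤ K * _ := mul_le_mul_of_nonneg_left b2 hK.le
      _ = _ := by rw [hL]; ring
  have tail : ∀ m : ℕ, |Q - ∑ j ∈ Finset.range m, q j| ≤ L * ((m : ℝ) + 1) ^ (β - 1) := by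
    intro m
    have part : ∀ N : ℕ, |∑ j ∈ Finset.range (m + N), q j - ∑ j ∈ Finset.range m, q j|
        ≤ L * (((m : ℝ) + 1) ^ (β - 1) - ((m : ℝ) + N + 1) ^ (β - 1)) := by
      intro N
      induction N with
      | zero => simp
      | succ N ih =>
        rw [← add_assoc, Finset.sum_range_succ]
        have := hqb (m + N)
        push_cast at this ⊢
        have e : ∑ j ∈ Finset.range (m + N), q j + q (m + N) - ∑ j ∈ Finset.range m, q j
          = (∑ j ∈ Finset.range (m + N), q j - ∑ j ∈ Finset.range m, q j) + q (m + N) := by ring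
        rw [e]
        refine (abs_add_le _ _).trans ((add_le_add ih this).trans (le_of_eq ?_))
        ring_nf
    have lim : Tendsto (fun N : ℕ => |∑ j ∈ Finset.range (m + N), q j - ∑ j ∈ Finset.range m, q j|)
        atTop (𝓝 |Q - ∑ j ∈ Finset.range m, q j|) := by
      have := hQ.tendsto_sum_nat.comp (tendsto_add_atTop_nat m)
      have h2 := (this.sub_const (∑ j ∈ Finset.range m, q j)).abs
      refine h2.congr fun N => ?_
      simp [add_comm]
    refine le_of_tendsto' lim fun N => (part N).trans ?_
    have : 0 ≤ ((m : ℝ) + N + 1) ^ (β - 1) := by positivity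
    gcongr
    linarith
  have row : ∀ s ∈ Finset.range n, |∑ t ∈ Finset.range n, p ((s : ℤ) - t) - S|
      ≤ L * ((s : ℝ) + 1) ^ (β - 1) + L * (((n - 1 - s : ℕ) : ℝ) + 1) ^ (β - 1) := by
    intro s hs
    rw [Finset.mem_range] at hs
    have e := row_sum p hp s (n - 1 - s)
    have e0 : s + 1 + (n - 1 - s) = n := by omega
    rw [e0] at e
    rw [e, hSQ]
    have e1 : p 0 + ∑ j ∈ Finset.range s, p ((j : ℤ) + 1)
        + ∑ j ∈ Finset.range (n - 1 - s), p ((j : ℤ) + 1) - (p 0 + Q + Q)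
        = -((Q - ∑ j ∈ Finset.range s, q j) + (Q - ∑ j ∈ Finset.range (n - 1 - s), q j)) := by
      simp only [hq]; ring
    rw [e1, abs_neg]
    exact (abs_add_le _ _).trans (add_le_add (tail _) (tail _))
  have e : (n : ℝ)⁻¹ * ∑ s ∈ Finset.range n, ∑ t ∈ Finset.range n, p ((s : ℤ) - t) - S
      = (n : ℝ)⁻¹ * ∑ s ∈ Finset.range n, (∑ t ∈ Finset.range n, p ((s : ℤ) - t) - S) := by
    rw [Finset.sum_sub_distrib, Finset.sum_const, Finset.card_range, nsmul_eq_mul]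
    field_simp
  rw [e, abs_mul, abs_of_pos (inv_pos.2 hn0)]
  have tot : |∑ s ∈ Finset.range n, (∑ t ∈ Finset.range n, p ((s : ℤ) - t) - S)|
      ≤ 2 * L * ((n : ℝ) ^ β / β) := by
    refine (Finset.abs_sum_le_sum_abs _ _).trans ((Finset.sum_le_sum row).trans ?_)
    rw [Finset.sum_add_distrib,
      Finset.sum_range_reflect (fun s : ℕ => L * ((s : ℝ) + 1) ^ (β - 1)) n, ← Finset.mul_sum]
    have := sum_pow_le h0 h1 n
    nlinarith
  calc _ ≤ (n : ℝ)⁻¹ * (2 * L * ((n : ℝ) ^ β / β)) := by gcongr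
    _ = _ := by
      rw [Real.rpow_add hn0, Real.rpow_neg_one, hL]
      field_simp
      ring

theorem stmt7 (h : Fin 2 → ℝ → ℝ)
    (heven : ∀ i, ∀ x : ℝ, h i (-x) = h i x)
    (hper : ∀ i, Function.Periodic (h i) (2 * π))
    (α : Fin 2 → ℝ) (C₁ C₂ : Fin 2 → ℝ)
    (hα : ∀ i, 0 < α i ∧ α i < 1) (hαsum : α 0 + α 1 < 1)
    (hC₁ : ∀ i, 0 < C₁ i) (hC₂ : ∀ i, 0 < C₂ i)
    (hdiff : ∀ i, ∀ x ∈ Ioc (-π) π, x ≠ 0 → DifferentiableAt ℝ (h i) x)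
    (hbound : ∀ i, ∀ x ∈ Ioc (-π) π, x ≠ 0 → |h i x| ≤ C₁ i * |x| ^ (-(α i)))
    (hbound' : ∀ i, ∀ x ∈ Ioc (-π) π, x ≠ 0 →
      |deriv (h i) x| ≤ C₂ i * |x| ^ (-(α i + 1))) :
    (fun n : ℕ => Δ₂B (h 0) (h 1) n) =O[atTop]
      fun n : ℕ => (n : ℝ) ^ (-1 + (α 0 + α 1)) := by
  have hpi := pi_pos
  have good : ∀ i, GoodFn (h i) (α i) (C₁ i) (C₂ i) := by
    intro i
    have hm : ∀ x ∈ Ioc 0 π, x ∈ Ioc (-π) π ∧ x ≠ 0 := fun x hx =>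
      ⟨⟨by linarith [hx.1], hx.2⟩, hx.1.ne'⟩
    refine ⟨heven i, (hα i).1, (hα i).2, hC₁ i, hC₂ i, fun x hx => ?_, fun x hx => ?_,
      fun x hx => ?_⟩
    · exact hdiff i x (hm x hx).1 (hm x hx).2
    · simpa [abs_of_pos hx.1] using hbound i x (hm x hx).1 (hm x hx).2
    · have := hbound' i x (hm x hx).1 (hm x hx).2
      rw [abs_of_pos hx.1] at this
      have e : -α i - 1 = -(α i + 1) := by ring
      rwa [e]
  have fc : ∀ i t, fcT (h i) t = ((cco (h i) 0 t : ℝ) : ℂ) := by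
    intro i t
    rw [← even_fourier (h i) (heven i) (good i).intble t, fcT,
      intervalIntegral.integral_of_le (by linarith)]
  set p : ℤ → ℝ := fun t => cco (h 0) 0 t * cco (h 1) 0 t with hp
  have ce : ∀ (g : ℝ → ℝ) t, cco g 0 (-t) = cco g 0 t := fun g t => by simp [cco]
  have hS := parseval_full (good 0) (good 1) hαsum
  obtain ⟨K, k0, -, k2⟩ := prod_bound (good 0) (good 1)
  have hI : (∫ x in Ioc (-π) π, h 0 x * h 1 x) = 2 * ∫ x in (0:ℝ)..π, h 0 x * h 1 x := by
    rw [← even_int (fun x => h 0 x * h 1 x) (fun x => by simp only [heven])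
      ((good 0).intble_mul (good 1) hαsum), intervalIntegral.integral_of_le (by linarith)]
  have htr : ∀ n : ℕ, Matrix.trace (BT n (h 0) * BT n (h 1))
      = ((∑ s ∈ Finset.range n, ∑ t ∈ Finset.range n, p ((s : ℤ) - t) : ℝ) : ℂ) := by
    intro n
    rw [Finset.sum_range]
    simp only [Finset.sum_range, Matrix.trace, Matrix.diag, Matrix.mul_apply, BT, fc]
    push_cast
    refine Finset.sum_congr rfl fun s _ => Finset.sum_congr rfl fun t _ => ?_
    have : cco (h 1) 0 ((t : ℤ) - s) = cco (h 1) 0 ((s : ℤ) - t) := by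
      rw [← ce]; congr 1; ring
    rw [this, hp]
    push_cast
    rfl
  refine IsBigO.of_bound (4 * K / ((1 - (α 0 + α 1)) * (α 0 + α 1))) ?_
  filter_upwards [eventually_gt_atTop 0] with n hn
  have key := toeplitz_sum p (fun t => by simp only [hp, ce]) hS
    (by linarith [(hα 0).1, (hα 1).1]) hαsum k0 (fun t ht => k2 0 ⟨le_rfl, hpi.le⟩ t ht) n hn
  have e : ((n : ℂ))⁻¹ * ((∑ s ∈ Finset.range n, ∑ t ∈ Finset.range n, p ((s : ℤ) - t) : ℝ) : ℂ)
      - ((2 * π * (2 * ∫ x in (0:ℝ)..π, h 0 x * h 1 x) : ℝ) : ℂ)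
      = (((n : ℝ)⁻¹ * ∑ s ∈ Finset.range n, ∑ t ∈ Finset.range n, p ((s : ℤ) - t)
        - 2 * π * (2 * ∫ x in (0:ℝ)..π, h 0 x * h 1 x) : ℝ) : ℂ) := by
    push_cast; rfl
  rw [Δ₂B, htr, hI, e, Complex.norm_real, norm_norm, Real.norm_eq_abs, Real.norm_eq_abs,
    abs_of_nonneg (Real.rpow_nonneg (Nat.cast_nonneg n) _)]
  exact key
end
end
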